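/- arXiv:1312.5668 — 2 statements merged into one kernel-verified Lean document; each statement's English description precedes it below -/
import Mathlib

section
/- Let k be a field of characteristic different from 2, let D (with embedding φ : kΓ → D) be a division ring of quotients of the group algebra kΓ of the Heisenberg group Γ, and let * be a k-involution on D induced by an involution ⋆ on Γ. If there do not exist integers m, n such that x⋆ = λ^m·x and y⋆ = λ^n·y, then the multiplicative group D^× contains a free symmetric pair. -/
/-- The commutator `g⁻¹h⁻¹gh` used in the paper's convention. -/
def commS {G : Type*} [Group G] (g h : G) : G := g⁻¹ * h⁻¹ * g * h

/-- Relations of the Heisenberg group: `[[x,y],x] = [[x,y],y] = 1`. -/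
def heisRels : Set (FreeGroup (Fin 2)) :=
  { commS (commS (FreeGroup.of 0) (FreeGroup.of 1)) (FreeGroup.of 0),
    commS (commS (FreeGroup.of 0) (FreeGroup.of 1)) (FreeGroup.of 1) }

/-- The Heisenberg group, presented by `x, y` with `[[x,y],x] = [[x,y],y] = 1`. -/
abbrev Heisenberg : Type := PresentedGroup heisRels

/-- The generator `x` of the Heisenberg group. -/
def Hx : Heisenberg := PresentedGroup.of 0

/-- The generator `y` of the Heisenberg group. -/
def Hy : Heisenberg := PresentedGroup.of 1

/-- The central element `λ = [x,y]`. -/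
def Hlam : Heisenberg := commS Hx Hy

/-- A pair of elements of a group is free if the induced map from the free group
on two generators is injective. -/
def IsFreePair {G : Type*} [Group G] (u v : G) : Prop :=
  Function.Injective ⇑(FreeGroup.lift (fun b : Bool => if b then u else v) : FreeGroup Bool →* G)

/-- Normal-form coordinates on the Heisenberg group: `⟨i, j, l⟩` stands for
`x ^ i * y ^ j * λ ^ l`. -/
@[ext]
structure HeisCoord where
  /-- The exponent of `x`. -/
  i : ℤ
  /-- The exponent of `y`. -/
  j : ℤ
  /-- The exponent of `λ`. -/
  l : ℤ

namespace HeisCoord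

instance : Mul HeisCoord := ⟨fun g h => ⟨g.i + h.i, g.j + h.j, g.l + h.l - g.j * h.i⟩⟩
instance : One HeisCoord := ⟨⟨0, 0, 0⟩⟩
instance : Inv HeisCoord := ⟨fun g => ⟨-g.i, -g.j, -g.l - g.i * g.j⟩⟩

@[simp] lemma mul_i (g h : HeisCoord) : (g * h).i = g.i + h.i := rfl
@[simp] lemma mul_j (g h : HeisCoord) : (g * h).j = g.j + h.j := rfl
@[simp] lemma mul_l (g h : HeisCoord) : (g * h).l = g.l + h.l - g.j * h.i := rfl
@[simp] lemma one_i : (1 : HeisCoord).i = 0 := rfl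
@[simp] lemma one_j : (1 : HeisCoord).j = 0 := rfl
@[simp] lemma one_l : (1 : HeisCoord).l = 0 := rfl
@[simp] lemma inv_i (g : HeisCoord) : g⁻¹.i = -g.i := rfl
@[simp] lemma inv_j (g : HeisCoord) : g⁻¹.j = -g.j := rfl
@[simp] lemma inv_l (g : HeisCoord) : g⁻¹.l = -g.l - g.i * g.j := rfl

instance : Group HeisCoord :=
  Group.ofLeftAxioms (by intros; ext <;> simp <;> ring) (by intros; ext <;> simp)
    (by intros; ext <;> simp; ring)

/-- The generator `x` in coordinates. -/
def x : HeisCoord := ⟨1, 0, 0⟩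

/-- The generator `y` in coordinates. -/
def y : HeisCoord := ⟨0, 1, 0⟩

/-- The central generator `λ` in coordinates. -/
def z : HeisCoord := ⟨0, 0, 1⟩

@[simp] lemma x_i : x.i = 1 := rfl
@[simp] lemma x_j : x.j = 0 := rfl
@[simp] lemma x_l : x.l = 0 := rfl
@[simp] lemma y_i : y.i = 0 := rfl
@[simp] lemma y_j : y.j = 1 := rfl
@[simp] lemma y_l : y.l = 0 := rfl
@[simp] lemma z_i : z.i = 0 := rfl
@[simp] lemma z_j : z.j = 0 := rfl
@[simp] lemma z_l : z.l = 1 := rfl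

lemma x_zpow (n : ℤ) : x ^ n = ⟨n, 0, 0⟩ := by
  induction n using Int.induction_on with
  | zero => rfl
  | succ n ih => rw [zpow_add_one, ih]; ext <;> simp
  | pred n ih => rw [zpow_sub_one, ih]; ext <;> simp; ring

lemma y_zpow (n : ℤ) : y ^ n = ⟨0, n, 0⟩ := by
  induction n using Int.induction_on with
  | zero => rfl
  | succ n ih => rw [zpow_add_one, ih]; ext <;> simp
  | pred n ih => rw [zpow_sub_one, ih]; ext <;> simp; ring

lemma z_zpow (n : ℤ) : z ^ n = ⟨0, 0, n⟩ := by
  induction n using Int.induction_on with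
  | zero => rfl
  | succ n ih => rw [zpow_add_one, ih]; ext <;> simp
  | pred n ih => rw [zpow_sub_one, ih]; ext <;> simp; ring

lemma eq_zpow (g : HeisCoord) : g = x ^ g.i * y ^ g.j * z ^ g.l := by
  rw [x_zpow, y_zpow, z_zpow]; ext <;> simp

/-- Two elements whose commutator is central induce a homomorphism from the Heisenberg group. -/
def lift {K : Type*} [Group K] (X Y c : K) (hX : Commute c X) (hY : Commute c Y)
    (h : X * Y = Y * X * c) : HeisCoord →* K where
  toFun g := X ^ g.i * Y ^ g.j * c ^ g.l
  map_one' := by simp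
  map_mul' g g' := by
    have hYX : ∀ n : ℤ, Y * X ^ n = X ^ n * Y * c ^ (-n) := by
      have h1 : Y⁻¹ * X * Y = X * c := by
        rw [mul_assoc, h, mul_assoc Y, inv_mul_cancel_left]
      intro n
      have h2 : Y⁻¹ * X ^ n * Y = X ^ n * c ^ n := by
        have := conj_zpow (a := Y⁻¹) (b := X) (i := n)
        rw [inv_inv] at this
        rw [← this, h1, (hX.symm).mul_zpow]
      have h3 : X ^ n * Y = Y * X ^ n * c ^ n := by
        rw [mul_assoc Y, ← h2]; group
      rw [h3, zpow_neg, mul_inv_cancel_right]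
    have hYX' : ∀ m n : ℤ, Y ^ m * X ^ n = X ^ n * Y ^ m * c ^ (-(m * n)) := by
      intro m n
      have h1 : (X ^ n)⁻¹ * Y * X ^ n = Y * c ^ (-n) := by
        rw [mul_assoc, hYX, mul_assoc (X ^ n), inv_mul_cancel_left]
      have := conj_zpow (a := (X ^ n)⁻¹) (b := Y) (i := m)
      rw [inv_inv, h1, ((hY.zpow_left (-n)).symm).mul_zpow, ← zpow_mul] at this
      rw [mul_assoc, show -(m * n) = -n * m by ring, this]; group
    have e1 : Commute (c ^ g.l) (X ^ g'.i) := (hX.zpow_left _).zpow_right _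
    have e2 : Commute (c ^ g.l) (Y ^ g'.j) := (hY.zpow_left _).zpow_right _
    have e3 : Commute (c ^ (-(g.j * g'.i))) (Y ^ g'.j) := (hY.zpow_left _).zpow_right _
    calc X ^ (g.i + g'.i) * Y ^ (g.j + g'.j) * c ^ (g.l + g'.l - g.j * g'.i)
        = X ^ (g.i + g'.i) * Y ^ (g.j + g'.j) * c ^ (-(g.j * g'.i) + g.l + g'.l) := by
          congr 2; ring
      _ = X ^ g.i * X ^ g'.i * Y ^ g.j * (Y ^ g'.j * c ^ (-(g.j * g'.i))) * c ^ g.l * c ^ g'.l := by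
          simp only [zpow_add, mul_assoc]
      _ = X ^ g.i * (X ^ g'.i * Y ^ g.j * c ^ (-(g.j * g'.i))) * (Y ^ g'.j * c ^ g.l) *
          c ^ g'.l := by
          rw [← e3.eq]; simp only [mul_assoc]
      _ = X ^ g.i * Y ^ g.j * (X ^ g'.i * c ^ g.l) * Y ^ g'.j * c ^ g'.l := by
          rw [← hYX', ← e2.eq]; simp only [mul_assoc]
      _ = _ := by rw [← e1.eq]; simp only [mul_assoc]

lemma lift_apply {K : Type*} [Group K] (X Y c : K) (hX : Commute c X) (hY : Commute c Y)
    (h : X * Y = Y * X * c) (g : HeisCoord) :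
    lift X Y c hX hY h g = X ^ g.i * Y ^ g.j * c ^ g.l := rfl

end HeisCoord

lemma commS_eq_one_iff {G : Type*} [Group G] (g h : G) : commS g h = 1 ↔ g * h = h * g := by
  unfold commS
  rw [mul_assoc, ← mul_inv_rev, inv_mul_eq_one, eq_comm]

lemma map_commS {G K : Type*} [Group G] [Group K] (f : G →* K) (g h : G) :
    f (commS g h) = commS (f g) (f h) := by
  simp [commS]

lemma commS_heisCoord : commS HeisCoord.x HeisCoord.y = HeisCoord.z := by
  ext <;> simp [commS]

/-- Coordinates on the Heisenberg group, as a homomorphism. -/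
def heisToCoord : Heisenberg →* HeisCoord :=
  PresentedGroup.toGroup (f := ![HeisCoord.x, HeisCoord.y]) (by
    rintro r (rfl | rfl) <;>
    · simp only [map_commS, FreeGroup.lift_apply_of, Matrix.cons_val_zero, Matrix.cons_val_one,
        commS_heisCoord, commS_eq_one_iff]
      ext <;> simp)

lemma Hlam_commute_Hx : Commute Hlam Hx := by
  refine (commS_eq_one_iff _ _).1 ?_
  have h : (PresentedGroup.mk heisRels) (commS (commS (FreeGroup.of 0) (FreeGroup.of 1))
    (FreeGroup.of 0)) = 1 := PresentedGroup.one_of_mem (by simp [heisRels])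
  rwa [map_commS, map_commS] at h

lemma Hlam_commute_Hy : Commute Hlam Hy := by
  refine (commS_eq_one_iff _ _).1 ?_
  have h : (PresentedGroup.mk heisRels) (commS (commS (FreeGroup.of 0) (FreeGroup.of 1))
    (FreeGroup.of 1)) = 1 := PresentedGroup.one_of_mem (by simp [heisRels])
  rwa [map_commS, map_commS] at h

/-- The Heisenberg group is isomorphic to its group of coordinates. -/
def heisEquiv : Heisenberg ≃* HeisCoord :=
  MonoidHom.toMulEquiv heisToCoord
    (HeisCoord.lift Hx Hy Hlam Hlam_commute_Hx Hlam_commute_Hy (by unfold Hlam commS; group))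
    (by
      refine PresentedGroup.ext fun n => ?_
      fin_cases n <;> simp [heisToCoord, HeisCoord.lift_apply, Hx, Hy])
    (by
      have hx : heisToCoord Hx = HeisCoord.x := by simp [heisToCoord, Hx]
      have hy : heisToCoord Hy = HeisCoord.y := by simp [heisToCoord, Hy]
      have hz : heisToCoord Hlam = HeisCoord.z := by
        rw [Hlam, map_commS, hx, hy, commS_heisCoord]
      ext1 g
      rw [MonoidHom.comp_apply, HeisCoord.lift_apply, map_mul, map_mul, map_zpow, map_zpow,
        map_zpow, hx, hy, hz, ← HeisCoord.eq_zpow, MonoidHom.id_apply])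

lemma heisEquiv_Hx : heisEquiv Hx = HeisCoord.x := by
  change heisToCoord Hx = _
  simp [heisToCoord, Hx]

lemma heisEquiv_Hy : heisEquiv Hy = HeisCoord.y := by
  change heisToCoord Hy = _
  simp [heisToCoord, Hy]

lemma heisEquiv_Hlam : heisEquiv Hlam = HeisCoord.z := by
  rw [Hlam, ← MulEquiv.coe_toMonoidHom, map_commS, MulEquiv.coe_toMonoidHom, heisEquiv_Hx,
    heisEquiv_Hy, commS_heisCoord]

namespace HeisCoord

/-- The sign `(-1) ^ n` in a ring. -/
def sgn (B : Type*) [Ring B] (n : ℤ) : B := ((n.negOnePow : ℤ) : B)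

section sgn

variable {B : Type*} [Ring B]

@[simp] lemma sgn_zero : sgn B 0 = 1 := by simp [sgn]
@[simp] lemma sgn_one : sgn B 1 = -1 := by simp [sgn]
lemma sgn_add (m n : ℤ) : sgn B (m + n) = sgn B m * sgn B n := by simp [sgn, Int.negOnePow_add]
lemma sgn_neg (n : ℤ) : sgn B (-n) = sgn B n := by simp [sgn, Int.negOnePow_neg]
lemma sgn_of_even {n : ℤ} (h : Even n) : sgn B n = 1 := by simp [sgn, Int.negOnePow_even n h]
lemma sgn_of_odd {n : ℤ} (h : Odd n) : sgn B n = -1 := by simp [sgn, Int.negOnePow_odd n h]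
lemma sgn_mul_self (n : ℤ) : sgn B n * sgn B n = 1 := by
  rw [← sgn_add, sgn_of_even ⟨n, rfl⟩]

lemma sgn_eq_or (n : ℤ) : sgn B n = 1 ∨ sgn B n = -1 :=
  (Int.even_or_odd n).imp sgn_of_even sgn_of_odd

lemma map_sgn {C : Type*} [Ring C] (f : B →+* C) (n : ℤ) : f (sgn B n) = sgn C n := by simp [sgn]

end sgn

/-- The value at `x ^ i * y ^ j * λ ^ l` of the representation sending `x` to `t * diag(1, -1)`,
`y` to `s` times the swap matrix and `λ` to `-1`, where `χ (i, j) = t ^ i * s ^ j`. -/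
def repMat {B : Type*} [CommRing B] (χ : Multiplicative (ℤ × ℤ) →* B) (g : HeisCoord) :
    Matrix (Fin 2) (Fin 2) B :=
  (sgn B g.l * χ (.ofAdd (g.i, g.j))) •
    if Even g.j then !![1, 0; 0, sgn B g.i] else !![0, 1; sgn B g.i, 0]

/-- The two-dimensional representation of the Heisenberg group with `λ` acting as `-1`. -/
def rep {B : Type*} [CommRing B] (χ : Multiplicative (ℤ × ℤ) →* B) :
    HeisCoord →* Matrix (Fin 2) (Fin 2) B where
  toFun := repMat χ
  map_one' := by
    have : χ (.ofAdd ((0 : ℤ), (0 : ℤ))) = 1 := map_one χ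
    simp [repMat, this, Matrix.one_fin_two]
  map_mul' g h := by
    have hχ : χ (.ofAdd (g.i + h.i, g.j + h.j)) = χ (.ofAdd (g.i, g.j)) * χ (.ofAdd (h.i, h.j)) :=
      map_mul χ (.ofAdd (g.i, g.j)) (.ofAdd (h.i, h.j))
    have hs : sgn B (g.l + h.l - g.j * h.i) =
        sgn B g.l * sgn B h.l * if Even g.j then 1 else sgn B h.i := by
      rw [sub_eq_add_neg, sgn_add, sgn_add, sgn_neg]
      split_ifs with hg
      · rw [sgn_of_even (hg.mul_right _)]
      · congr 1
        rcases Int.even_or_odd h.i with hh | hh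
        · rw [sgn_of_even hh, sgn_of_even (hh.mul_left _)]
        · rw [sgn_of_odd hh, sgn_of_odd ((Int.not_even_iff_odd.1 hg).mul hh)]
    simp only [repMat, mul_i, mul_j, mul_l, hχ, hs, sgn_add, Int.even_add]
    have hi := sgn_mul_self (B := B) h.i
    by_cases hg : Even g.j <;> by_cases hh : Even h.j <;>
    · ext a b
      fin_cases a <;> fin_cases b <;>
        simp [hg, hh, Matrix.mul_apply, Fin.sum_univ_two] <;> grind

lemma rep_apply {B : Type*} [CommRing B] (χ : Multiplicative (ℤ × ℤ) →* B) (g : HeisCoord) :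
    rep χ g = (sgn B g.l * χ (.ofAdd (g.i, g.j))) •
    if Even g.j then !![1, 0; 0, sgn B g.i] else !![0, 1; sgn B g.i, 0] := rfl

lemma rep_map {B C : Type*} [CommRing B] [CommRing C] (χ : Multiplicative (ℤ × ℤ) →* B)
    (f : B →+* C) (g : HeisCoord) :
    (rep χ g).map f = rep ((f : B →* C).comp χ) g := by
  simp only [rep_apply]
  split_ifs <;>
  · ext a b
    fin_cases a <;> fin_cases b <;> simp [map_sgn]

section generic

variable (k : Type*) [Field k]

/-- The generic specialization of the Heisenberg group algebra at `λ = -1`. -/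
noncomputable def gen : MonoidAlgebra k HeisCoord →ₐ[k]
    Matrix (Fin 2) (Fin 2) (AddMonoidAlgebra k (ℤ × ℤ)) :=
  MonoidAlgebra.lift k _ _ (rep (AddMonoidAlgebra.of k (ℤ × ℤ)))

/-- The reduction of an element of the group algebra modulo `λ + 1`, recorded in the commutative
algebra with basis the monomials `x ^ i * y ^ j`. -/
noncomputable def red : MonoidAlgebra k HeisCoord →ₗ[k] AddMonoidAlgebra k (ℤ × ℤ) where
  toFun a := a.coeff.sum fun g c => AddMonoidAlgebra.single (g.i, g.j) (c * sgn k g.l)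
  map_add' a b := by
    rw [MonoidAlgebra.coeff_add, Finsupp.sum_add_index'] <;> simp [add_mul]
  map_smul' r a := by
    rw [MonoidAlgebra.coeff_smul, Finsupp.sum_smul_index (by simp), RingHom.id_apply,
      Finsupp.smul_sum]
    simp [mul_assoc]

/-- The section of `red` writing a monomial as `x ^ i * y ^ j`. -/
noncomputable def sec : AddMonoidAlgebra k (ℤ × ℤ) →ₗ[k] MonoidAlgebra k HeisCoord where
  toFun a := a.coeff.sum fun p c => MonoidAlgebra.single ⟨p.1, p.2, 0⟩ c
  map_add' a b := by
    rw [AddMonoidAlgebra.coeff_add, Finsupp.sum_add_index'] <;> simp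
  map_smul' r a := by
    rw [AddMonoidAlgebra.coeff_smul, Finsupp.sum_smul_index (by simp), RingHom.id_apply,
      Finsupp.smul_sum]
    simp

variable {k}

lemma red_single (g : HeisCoord) (c : k) :
    red k (.single g c) = .single (g.i, g.j) (c * sgn k g.l) := by
  simp [red]

lemma sec_single (p : ℤ × ℤ) (c : k) :
    sec k (.single p c) = .single ⟨p.1, p.2, 0⟩ c := by
  simp [sec]

lemma gen_single (g : HeisCoord) (c : k) :
    gen k (.single g c) = c • rep (AddMonoidAlgebra.of k (ℤ × ℤ)) g := by
  simp [gen]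

lemma coeff_gen (a : MonoidAlgebra k HeisCoord) (p : ℤ × ℤ) :
    (gen k a 0 0).coeff p = (if Even p.2 then (red k a).coeff p else 0) ∧
    (gen k a 0 1).coeff p = (if Even p.2 then 0 else (red k a).coeff p) ∧
    (gen k a 1 1).coeff p = (if Even p.2 then sgn k p.1 * (red k a).coeff p else 0) ∧
    (gen k a 1 0).coeff p = (if Even p.2 then 0 else sgn k p.1 * (red k a).coeff p) := by
  induction a using MonoidAlgebra.induction_linear with
  | zero => simp
  | add a b ha hb =>
    obtain ⟨ha1, ha2, ha3, ha4⟩ := ha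
    obtain ⟨hb1, hb2, hb3, hb4⟩ := hb
    simp only [map_add, Matrix.add_apply, AddMonoidAlgebra.coeff_add, Finsupp.add_apply, ha1, ha2,
      ha3, ha4, hb1, hb2, hb3, hb4]
    split_ifs <;> simp [mul_add]
  | single g c =>
    have hS : ∀ n : ℤ, sgn (AddMonoidAlgebra k (ℤ × ℤ)) n = .single 0 (sgn k n) := by
      intro n
      rcases Int.even_or_odd n with h | h
      · rw [sgn_of_even h, sgn_of_even h]; rfl
      · rw [sgn_of_odd h, sgn_of_odd h, AddMonoidAlgebra.single_neg]; rfl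
    have hp : p = (g.i, g.j) ∨ (g.i, g.j) ≠ p := by tauto
    rw [red_single, gen_single, rep_apply]
    simp only [AddMonoidAlgebra.of_apply, hS]
    rcases hp with rfl | hp
    · split_ifs with h <;>
        simp [AddMonoidAlgebra.single_mul_single, mul_comm, mul_left_comm,
          AddMonoidAlgebra.coeff_single]
    · by_cases h : Even g.j <;>
        simp [h, AddMonoidAlgebra.single_mul_single, mul_comm, AddMonoidAlgebra.coeff_single, hp]

lemma exists_lex_max_support {f f' : AddMonoidAlgebra k (ℤ × ℤ)}
    (h : ∀ p, f'.coeff p = 0 ↔ f.coeff p = 0) (hf : f * f' ≠ 0) :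
    ∃ p, f.coeff p ≠ 0 ∧ (f * f').coeff (p + p) ≠ 0 ∧
      ∀ r, (f * f').coeff r ≠ 0 → (toLex r : ℤ ×ₗ ℤ) ≤ toLex (p + p) := by
  classical
  have hs : f'.coeff.support = f.coeff.support := by
    ext p
    simp [h]
  obtain ⟨p, hp, hmax⟩ := f.coeff.support.exists_max_image (fun p => (toLex p : ℤ ×ₗ ℤ))
    (by simpa using left_ne_zero_of_mul hf)
  have hu : UniqueAdd f.coeff.support f'.coeff.support p p := by
    intro a b ha hb hab
    have hab' : (toLex a : ℤ ×ₗ ℤ) + toLex b = toLex p + toLex p := congrArg toLex hab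
    have h1 := hmax a ha
    have h2 := hmax b (hs ▸ hb)
    obtain ⟨e1, e2⟩ := (add_eq_add_iff_eq_and_eq h1 h2).1 hab'
    exact ⟨toLex.injective e1, toLex.injective e2⟩
  have hp0 := Finsupp.mem_support_iff.1 hp
  refine ⟨p, hp0, ?_, fun r hr => ?_⟩
  · rw [AddMonoidAlgebra.coeff_mul_add_of_uniqueAdd hu]
    exact mul_ne_zero hp0 (mt (h p).1 hp0)
  · obtain ⟨a, ha, b, hb, rfl⟩ := Finset.mem_add.1
      (AddMonoidAlgebra.support_coeff_mul_subset f f' (Finsupp.mem_support_iff.2 hr))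
    exact add_le_add (hmax a ha) (hmax b (hs ▸ hb))

lemma sgn_ne_zero {B : Type*} [Ring B] [Nontrivial B] (n : ℤ) : sgn B n ≠ 0 := by
  rcases sgn_eq_or (B := B) n with h | h <;> simp [h]

lemma det_gen_ne_zero {a : MonoidAlgebra k HeisCoord} (ha : red k a ≠ 0) :
    (gen k a).det ≠ 0 := by
  have hc := coeff_gen a
  rw [Matrix.det_fin_two]
  generalize gen k a 0 0 = e, gen k a 0 1 = o, gen k a 1 1 = e', gen k a 1 0 = o' at hc ⊢
  have he (p) : e'.coeff p = 0 ↔ e.coeff p = 0 := by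
    obtain ⟨h1, h2, h3, h4⟩ := hc p
    rw [h1, h3]; split_ifs <;> simp [sgn_ne_zero]
  have ho (p) : o'.coeff p = 0 ↔ o.coeff p = 0 := by
    obtain ⟨h1, h2, h3, h4⟩ := hc p
    rw [h2, h4]; split_ifs <;> simp [sgn_ne_zero]
  have zero_of {f f' : AddMonoidAlgebra k (ℤ × ℤ)}
      (h : ∀ p, f'.coeff p = 0 ↔ f.coeff p = 0) (hf : f * f' = 0) : f = 0 := by
    rcases mul_eq_zero.1 hf with h0 | h0
    · exact h0
    · ext p
      exact (h p).1 (by simp [h0])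
  intro hdet
  have hdet' : e * e' = o * o' := sub_eq_zero.1 hdet
  by_cases he0 : e = 0
  · have ho0 : o = 0 := zero_of ho (by rw [← hdet', he0, zero_mul])
    apply ha
    ext p
    obtain ⟨h1, h2, -, -⟩ := hc p
    rw [he0] at h1
    rw [ho0] at h2
    by_cases hp : Even p.2
    · simpa [hp] using h1.symm
    · simpa [hp] using h2.symm
  have hee : e * e' ≠ 0 := fun h => he0 (zero_of he h)
  have hoo : o * o' ≠ 0 := hdet' ▸ hee
  obtain ⟨p, hp, hp', hpm⟩ := exists_lex_max_support he hee
  obtain ⟨q, hq, hq', hqm⟩ := exists_lex_max_support ho hoo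
  have hpq : p + p = q + q :=
    toLex.injective (le_antisymm (hqm _ (hdet' ▸ hp')) (hpm _ (hdet' ▸ hq')))
  have hpe : Even p.2 := by
    by_contra h
    exact hp (by rw [(hc p).1, if_neg h])
  have hqe : ¬ Even q.2 := fun h => hq (by rw [(hc q).2.1, if_pos h])
  have : p.2 = q.2 := by
    have := congrArg Prod.snd hpq
    simp only [Prod.snd_add] at this
    omega
  exact hqe (this ▸ hpe)

lemma red_eq_zero_of_gen {a : MonoidAlgebra k HeisCoord} (h : gen k a = 0) : red k a = 0 := by
  by_contra h0
  exact det_gen_ne_zero h0 (by rw [h]; simp)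

lemma gen_eq_zero_of_red {a : MonoidAlgebra k HeisCoord} (h : red k a = 0) : gen k a = 0 := by
  ext r c p
  obtain ⟨h1, h2, h3, h4⟩ := coeff_gen a p
  rw [h] at h1 h2 h3 h4
  fin_cases r <;> fin_cases c <;> simp_all

variable (k) in
/-- The central element `λ + 1` of the group algebra. -/
noncomputable def zp : MonoidAlgebra k HeisCoord := MonoidAlgebra.single z 1 + 1

lemma z_mul_comm (g : HeisCoord) : z * g = g * z := by
  ext <;> simp [add_comm]

lemma zp_mul_comm (a : MonoidAlgebra k HeisCoord) : zp k * a = a * zp k := by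
  have : Commute (MonoidAlgebra.single z (1 : k)) a :=
    MonoidAlgebra.single_commute z_mul_comm (fun r => Commute.one_left r) a
  exact (this.add_left (Commute.one_left a)).eq

lemma coeff_zp_mul (a : MonoidAlgebra k HeisCoord) (g : HeisCoord) :
    (zp k * a).coeff g = a.coeff (z⁻¹ * g) + a.coeff g := by
  simp [zp, add_mul, MonoidAlgebra.coeff_single_mul_apply]

lemma gen_zp : gen k (zp k) = 0 := by
  apply gen_eq_zero_of_red
  rw [zp, map_add, MonoidAlgebra.one_def, red_single, red_single]
  simp

lemma exists_sub_sec_red (a : MonoidAlgebra k HeisCoord) :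
    ∃ b, a - sec k (red k a) = zp k * b := by
  induction a using MonoidAlgebra.induction_linear with
  | zero => exact ⟨0, by simp⟩
  | add a b ha hb =>
    obtain ⟨a', ha⟩ := ha
    obtain ⟨b', hb⟩ := hb
    exact ⟨a' + b', by rw [mul_add, ← ha, ← hb, map_add, map_add]; abel⟩
  | single g c =>
    obtain ⟨i, j, l⟩ := g
    rw [red_single, sec_single]
    have key (l : ℤ) : zp k * .single ⟨i, j, l⟩ c =
        .single ⟨i, j, l + 1⟩ c + .single ⟨i, j, l⟩ c := by
      rw [zp, add_mul, MonoidAlgebra.single_mul_single, one_mul, one_mul]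
      congr 2
      ext <;> simp [add_comm]
    induction l using Int.induction_on with
    | zero => exact ⟨0, by simp⟩
    | succ l ih =>
      obtain ⟨b, hb⟩ := ih
      refine ⟨.single ⟨i, j, l⟩ c - b, ?_⟩
      rw [mul_sub, key, ← hb]
      simp only [sgn_add, sgn_one, mul_neg, mul_one,
        MonoidAlgebra.single_neg]
      abel
    | pred l ih =>
      obtain ⟨b, hb⟩ := ih
      refine ⟨.single ⟨i, j, -l - 1⟩ c - b, ?_⟩
      rw [mul_sub, key, ← hb]
      simp only [sub_eq_add_neg, sgn_add, sgn_neg, sgn_one, mul_neg, mul_one,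
        MonoidAlgebra.single_neg, neg_add_cancel_right]
      abel

lemma exists_zp_mul {a : MonoidAlgebra k HeisCoord} (h : red k a = 0) : ∃ b, a = zp k * b := by
  obtain ⟨b, hb⟩ := exists_sub_sec_red a
  exact ⟨b, by rwa [h, map_zero, sub_zero] at hb⟩

lemma support_bound_of_zp_mul {b : MonoidAlgebra k HeisCoord} {m n : ℤ}
    (h : ∀ g, (zp k * b).coeff g ≠ 0 → m ≤ g.l ∧ g.l ≤ n) (g : HeisCoord) (hg : b.coeff g ≠ 0) :
    m ≤ g.l ∧ g.l + 1 ≤ n := by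
  classical
  obtain ⟨g₁, hg₁, hmax⟩ := b.coeff.support.exists_max_image HeisCoord.l
    ⟨g, Finsupp.mem_support_iff.2 hg⟩
  obtain ⟨g₂, hg₂, hmin⟩ := b.coeff.support.exists_min_image HeisCoord.l
    ⟨g, Finsupp.mem_support_iff.2 hg⟩
  rw [Finsupp.mem_support_iff] at hg₁ hg₂
  have h1 : (z * g₁).l = g₁.l + 1 := by simp [add_comm]
  have h2 : (z⁻¹ * g₂).l = g₂.l - 1 := by simp; ring
  have h1' : b.coeff (z * g₁) = 0 := by
    by_contra hne
    have := hmax _ (Finsupp.mem_support_iff.2 hne)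
    omega
  have h2' : b.coeff (z⁻¹ * g₂) = 0 := by
    by_contra hne
    have := hmin _ (Finsupp.mem_support_iff.2 hne)
    omega
  have b1 := (h (z * g₁) (by rw [coeff_zp_mul, inv_mul_cancel_left, h1', add_zero]; exact hg₁)).2
  have b2 := (h g₂ (by rw [coeff_zp_mul, h2', zero_add]; exact hg₂)).1
  have c1 := hmax g (Finsupp.mem_support_iff.2 hg)
  have c2 := hmin g (Finsupp.mem_support_iff.2 hg)
  omega

lemma zp_ne_zero : zp k ≠ 0 := by
  intro h
  have : (zp k).coeff z = 1 := by
    have : (1 : HeisCoord) ≠ z := fun h => by simpa using congrArg HeisCoord.l h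
    simp [zp, MonoidAlgebra.one_def, MonoidAlgebra.coeff_single, this]
  simp [h] at this

/-- A common right multiple `a * s' = s * a'` with `s' ≠ 0` can be chosen with `s'` not divisible
by `λ + 1`. -/
lemma exists_ore_red_ne_zero [NoZeroDivisors (MonoidAlgebra k HeisCoord)]
    {a s a' s' : MonoidAlgebra k HeisCoord} (hs : red k s ≠ 0) (hs' : s' ≠ 0)
    (h : a * s' = s * a') : ∃ a'' s'', red k s'' ≠ 0 ∧ a * s'' = s * a'' := by
  classical
  obtain ⟨m, n, hmn⟩ : ∃ m : ℤ, ∃ n : ℕ, ∀ g, s'.coeff g ≠ 0 → m ≤ g.l ∧ g.l ≤ m + n := by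
    obtain ⟨g, hg⟩ : s'.coeff.support.Nonempty := by simpa using hs'
    obtain ⟨g₁, hg₁, hmax⟩ := s'.coeff.support.exists_max_image HeisCoord.l ⟨g, hg⟩
    obtain ⟨g₂, hg₂, hmin⟩ := s'.coeff.support.exists_min_image HeisCoord.l ⟨g, hg⟩
    refine ⟨g₂.l, (g₁.l - g₂.l).toNat, fun g hg => ?_⟩
    have c1 := hmax g (Finsupp.mem_support_iff.2 hg)
    have c2 := hmin g (Finsupp.mem_support_iff.2 hg)
    omega
  induction n generalizing s' a' with
  | zero =>
    refine ⟨a', s', fun h0 => ?_, h⟩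
    obtain ⟨b, rfl⟩ := exists_zp_mul h0
    obtain ⟨g, hg⟩ : b.coeff.support.Nonempty := by simpa using right_ne_zero_of_mul hs'
    have := support_bound_of_zp_mul hmn g (Finsupp.mem_support_iff.1 hg)
    omega
  | succ n ih =>
    by_cases h0 : red k s' = 0
    · obtain ⟨b, rfl⟩ := exists_zp_mul h0
      have ha' : red k a' = 0 := by
        apply red_eq_zero_of_gen
        have := congrArg (gen k) h
        rw [map_mul, map_mul, map_mul, gen_zp, zero_mul, mul_zero] at this
        have := congrArg ((gen k s).adjugate * ·) this
        simp only [mul_zero, ← mul_assoc, Matrix.adjugate_mul, smul_mul_assoc, one_mul] at this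
        exact (smul_eq_zero.1 this.symm).resolve_left (det_gen_ne_zero hs)
      obtain ⟨b', rfl⟩ := exists_zp_mul ha'
      refine ih (s' := b) (a' := b') (right_ne_zero_of_mul hs') ?_ ?_
      · refine mul_left_cancel₀ (zp_ne_zero (k := k)) ?_
        rw [← mul_assoc, ← mul_assoc, zp_mul_comm, zp_mul_comm, mul_assoc, mul_assoc, h]
      · intro g hg
        have := support_bound_of_zp_mul hmn g hg
        push_cast at this
        omega
    · exact ⟨a', s', h0, h⟩

section specialization

open Matrix

variable {D : Type*} [DivisionRing D] [Algebra k D] {φ : MonoidAlgebra k HeisCoord →ₐ[k] D}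

variable (φ) in
/-- `N` is, up to a nonzero scalar, the image of `d` under the extension of `gen k` to fractions
whose denominator has nonzero reduction. -/
def Specializes (d : D) (N : Matrix (Fin 2) (Fin 2) (AddMonoidAlgebra k (ℤ × ℤ))) : Prop :=
  ∃ a b : MonoidAlgebra k HeisCoord, ∃ c : AddMonoidAlgebra k (ℤ × ℤ),
    red k b ≠ 0 ∧ c ≠ 0 ∧ d * φ b = φ a ∧ N * gen k b = c • gen k a

lemma red_ne_zero_of_gen {a : MonoidAlgebra k HeisCoord} (h : gen k a ≠ 0) : red k a ≠ 0 :=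
  fun h0 => h (gen_eq_zero_of_red h0)

lemma Specializes.one : Specializes φ 1 1 := by
  refine ⟨1, 1, 1, red_ne_zero_of_gen ?_, one_ne_zero, by simp, by simp⟩
  rw [map_one]
  exact one_ne_zero

lemma Specializes.mul (hφ : Function.Injective φ)
    (hquot : ∀ d : D, ∃ a b : MonoidAlgebra k HeisCoord, φ b ≠ 0 ∧ d = φ a * (φ b)⁻¹)
    {d d' : D} {N N' : Matrix (Fin 2) (Fin 2) (AddMonoidAlgebra k (ℤ × ℤ))}
    (h : Specializes φ d N) (h' : Specializes φ d' N') : Specializes φ (d * d') (N * N') := by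
  have : NoZeroDivisors (MonoidAlgebra k HeisCoord) :=
    hφ.noZeroDivisors φ (map_zero φ) (map_mul φ)
  obtain ⟨a, b, c, hb, hc, hd, hN⟩ := h
  obtain ⟨a', b', c', hb', hc', hd', hN'⟩ := h'
  have hb0 : φ b ≠ 0 := fun h => hb (by rw [hφ (h.trans (map_zero φ).symm), map_zero])
  obtain ⟨r, s, hs, hrs⟩ := hquot ((φ b)⁻¹ * φ a')
  have hore : a' * s = b * r := by
    apply hφ
    rw [map_mul, map_mul]
    have := congrArg (fun t => φ b * t * φ s) hrs
    simpa [mul_assoc, hs, hb0] using this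
  obtain ⟨a'', b'', hb'', hab⟩ := exists_ore_red_ne_zero hb
    (fun h => hs (by rw [h, map_zero])) hore
  refine ⟨a * a'', b' * b'', c * c', red_ne_zero_of_gen fun h0 => ?_, mul_ne_zero hc hc', ?_, ?_⟩
  · refine mul_ne_zero (det_gen_ne_zero hb') (det_gen_ne_zero hb'') ?_
    rw [← det_mul, ← map_mul, h0, det_zero]
  · calc d * d' * φ (b' * b'') = d * (d' * φ b' * φ b'') := by simp [mul_assoc]
      _ = d * φ b * φ a'' := by rw [hd', ← map_mul, hab, map_mul, mul_assoc]
      _ = φ (a * a'') := by rw [hd, map_mul]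
  · calc N * N' * gen k (b' * b'') = N * (N' * gen k b' * gen k b'') := by
          simp only [map_mul, mul_assoc]
      _ = c' • (N * gen k b * gen k a'') := by
          rw [hN', smul_mul, ← map_mul, hab, map_mul, Matrix.mul_smul, mul_assoc]
      _ = (c * c') • gen k (a * a'') := by
          rw [hN, map_mul, smul_mul, smul_smul, mul_comm c]

lemma Specializes.exists_eq_smul_one (hφ : Function.Injective φ)
    {N : Matrix (Fin 2) (Fin 2) (AddMonoidAlgebra k (ℤ × ℤ))} (h : Specializes φ 1 N) :
    ∃ c : AddMonoidAlgebra k (ℤ × ℤ), N = c • (1 : Matrix (Fin 2) (Fin 2) _) := by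
  obtain ⟨a, b, c, hb, hc, hd, hN⟩ := h
  rw [one_mul] at hd
  obtain rfl := hφ hd
  refine ⟨c, ?_⟩
  have := congrArg (· * (gen k b).adjugate) hN
  simp only [mul_assoc, mul_adjugate, smul_mul, Matrix.mul_smul, mul_one] at this
  rw [smul_comm] at this
  exact smul_right_injective _ (det_gen_ne_zero hb) this

lemma specializes_cayley (hφ : Function.Injective φ) {r : MonoidAlgebra k HeisCoord}
    (h : gen k (1 - r) ≠ 0) :
    Specializes φ (φ (1 + r) * (φ (1 - r))⁻¹) (gen k (1 + r) * (gen k (1 - r)).adjugate) := by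
  refine ⟨1 + r, 1 - r, (gen k (1 - r)).det, red_ne_zero_of_gen h,
    det_gen_ne_zero (red_ne_zero_of_gen h), ?_, ?_⟩
  · rw [inv_mul_cancel_right₀]
    intro h0
    exact h (by rw [hφ (h0.trans (map_zero φ).symm), map_zero])
  · rw [mul_assoc, adjugate_mul, Matrix.mul_smul, mul_one]

end specialization

end generic

lemma prod_map_ne_zero_of_isChain {α L M : Type*} [Field L] [Ring M] [Algebra L M] {n : α → M}
    {r : α → α → Prop} (h0 : ∀ a, n a ≠ 0)
    (h : ∀ a b, r a b → ∃ κ : L, κ ≠ 0 ∧ n b * n a * n b = κ • n b) :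
    ∀ l : List α, l ≠ [] → l.IsChain r → (l.map n).prod ≠ 0
  | [a], _, _ => by simpa using h0 a
  | a :: b :: l, _, hl => by
    rw [List.isChain_cons_cons] at hl
    intro h1
    obtain ⟨κ, hκ, hab⟩ := h a b hl.1
    refine prod_map_ne_zero_of_isChain h0 h (b :: l) (by simp) hl.2 ?_
    have := congrArg (n b * ·) h1
    simp only [List.map_cons, List.prod_cons, ← mul_assoc, hab, mul_zero] at this
    rw [smul_mul_assoc, smul_eq_zero] at this
    simpa using this.resolve_left hκ

section cayley

variable {M : Type*} [Ring M]

/-- `±E` or `±F`, according to a letter of the free group on two generators. -/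
def letter (E F : M) (c : Bool × Bool) : M :=
  bif c.2 then (bif c.1 then E else F) else -(bif c.1 then E else F)

lemma map_letter {M' : Type*} [Ring M'] (f : M →+* M') (E F : M) (c : Bool × Bool) :
    f (letter E F c) = letter (f E) (f F) c := by
  rcases c with ⟨_ | _, _ | _⟩ <;> simp [letter]

variable {E F : M}

lemma letter_mul_self (hE : E * E = 1) (hF : F * F = 1) (c : Bool × Bool) :
    letter E F c * letter E F c = 1 := by
  rcases c with ⟨_ | _, _ | _⟩ <;> simp [letter, hE, hF]

lemma letter_eq_or_anticommute (hEF : E * F = -(F * E)) {a b : Bool × Bool}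
    (h : a.1 = b.1 → a.2 = b.2) :
    letter E F a = letter E F b ∨
      letter E F b * letter E F a = -(letter E F a * letter E F b) := by
  rcases a with ⟨_ | _, _ | _⟩ <;> rcases b with ⟨_ | _, _ | _⟩ <;>
    simp_all [letter]

lemma one_add_mul_one_add {e : M} (he : e * e = 1) : (1 + e) * (1 + e) = 2 * (1 + e) := by
  rw [mul_add, mul_one, add_mul, one_mul, he, two_mul, add_comm e 1]

lemma one_add_mul_one_add_mul_one_add {e f : M} (he : e * e = 1) (hef : e * f = -(f * e)) :
    (1 + e) * (1 + f) * (1 + e) = 2 * (1 + e) := by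
  have : (1 + e) * (1 + f) * (1 + e) = 1 + 2 * e + e * e + (e * f + f * e) + (e * f * e + f) := by
    noncomm_ring
  rw [this, hef, neg_mul, mul_assoc, he]
  noncomm_ring

lemma exists_sandwich_eq_smul {L : Type*} [Field L] [Algebra L M] (h2 : (2 : L) ≠ 0)
    (hE : E * E = 1) (hF : F * F = 1) (hEF : E * F = -(F * E)) {a b : Bool × Bool}
    (h : a.1 = b.1 → a.2 = b.2) :
    ∃ κ : L, κ ≠ 0 ∧
      (1 + letter E F b) * (1 + letter E F b) * ((1 + letter E F a) * (1 + letter E F a)) *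
        ((1 + letter E F b) * (1 + letter E F b)) =
      κ • ((1 + letter E F b) * (1 + letter E F b)) := by
  have hb := letter_mul_self hE hF b
  have h2M : (2 : M) = algebraMap L M 2 := (map_ofNat _ 2).symm
  rw [one_add_mul_one_add hb, one_add_mul_one_add (letter_mul_self hE hF a)]
  simp only [h2M, ← Algebra.smul_def, smul_mul_assoc, mul_smul_comm, smul_smul]
  rcases letter_eq_or_anticommute hEF h with hab | hab
  · refine ⟨2 ^ 4, pow_ne_zero _ h2, ?_⟩
    rw [hab, one_add_mul_one_add hb, mul_assoc, one_add_mul_one_add hb]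
    simp only [h2M, ← Algebra.smul_def, mul_smul_comm, smul_smul]
    congr 1
    ring
  · refine ⟨2 ^ 3, pow_ne_zero _ h2, ?_⟩
    rw [one_add_mul_one_add_mul_one_add hb hab]
    simp only [h2M, ← Algebra.smul_def, smul_smul]
    congr 1
    ring

lemma one_add_letter_ne_zero [Nontrivial M] (h2 : IsUnit (2 : M)) (hE : E * E = 1)
    (hF : F * F = 1) (hEF : E * F = -(F * E)) (c : Bool × Bool) : 1 + letter E F c ≠ 0 := by
  intro h0
  have key : ∀ {e f : M}, f * f = 1 → e * f = -(f * e) → (e = 1 ∨ e = -1) → False := by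
    rintro e f hf hef he
    have hf0 : 2 * f = 0 := by
      rcases he with rfl | rfl
      · rw [one_mul, mul_one] at hef
        rw [two_mul]
        exact add_eq_zero_iff_eq_neg.2 hef
      · rw [two_mul]
        simpa [neg_eq_iff_add_eq_zero] using hef
    rw [h2.mul_right_eq_zero] at hf0
    simp [hf0] at hf
  have hFE : F * E = -(E * F) := by rw [hEF, neg_neg]
  rcases c with ⟨_ | _, _ | _⟩ <;> simp only [letter, cond_true, cond_false] at h0
  · exact key hE hFE (.inl (add_neg_eq_zero.1 h0).symm)
  · exact key hE hFE (.inr (add_eq_zero_iff_neg_eq.1 h0).symm)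
  · exact key hF hEF (.inl (add_neg_eq_zero.1 h0).symm)
  · exact key hF hEF (.inr (add_eq_zero_iff_neg_eq.1 h0).symm)

end cayley

section free

open Matrix

lemma adjugate_one_sub_eq {L : Type*} [Field L] (h2 : (2 : L) ≠ 0)
    {E F : Matrix (Fin 2) (Fin 2) L} (hF : F * F = 1) (hEF : E * F = -(F * E)) :
    (1 - E).adjugate = 1 + E := by
  have htr : E.trace = -E.trace := by
    calc E.trace = (E * F * F).trace := by rw [mul_assoc, hF, mul_one]
      _ = -E.trace := by rw [hEF, neg_mul, trace_neg, trace_mul_comm, ← mul_assoc, hF, one_mul]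
  have h0 : E 0 0 + E 1 1 = 0 := by
    rw [← trace_fin_two]
    refine (mul_eq_zero.1 (?_ : 2 * E.trace = 0)).resolve_left h2
    linear_combination htr
  rw [adjugate_fin_two]
  ext i j
  fin_cases i <;> fin_cases j <;> simp
  · linear_combination -h0
  · linear_combination -h0

variable {k : Type*} [Field k] {D : Type*} [DivisionRing D] [Algebra k D]
  {φ : MonoidAlgebra k HeisCoord →ₐ[k] D}

/-- Symmetric Cayley transforms of symmetric elements that specialize to anticommuting matrices
of square one form a free pair. -/
lemma exists_free_symmetric_pair (hφ : Function.Injective φ)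
    (hquot : ∀ d : D, ∃ a b : MonoidAlgebra k HeisCoord, φ b ≠ 0 ∧ d = φ a * (φ b)⁻¹)
    (invol : D →ₗ[k] D) (hinvol_mul : ∀ c d : D, invol (c * d) = invol d * invol c)
    (hinvol_invol : ∀ c : D, invol (invol c) = c)
    {p w : MonoidAlgebra k HeisCoord} (hp : invol (φ p) = φ p) (hw : invol (φ w) = φ w)
    {L : Type*} [Field L] (h2 : (2 : L) ≠ 0) (ev : AddMonoidAlgebra k (ℤ × ℤ) →+* L)
    (hE : (gen k p).map ev * (gen k p).map ev = 1) (hF : (gen k w).map ev * (gen k w).map ev = 1)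
    (hEF : (gen k p).map ev * (gen k w).map ev = -((gen k w).map ev * (gen k p).map ev)) :
    ∃ u v : Dˣ, IsFreePair u v ∧ invol (u : D) = (u : D) ∧ invol (v : D) = (v : D) := by
  let Ψ : MonoidAlgebra k HeisCoord →+* Matrix (Fin 2) (Fin 2) L :=
    ev.mapMatrix.comp (gen k : MonoidAlgebra k HeisCoord →+* _)
  change Ψ p * Ψ p = 1 at hE
  change Ψ w * Ψ w = 1 at hF
  change Ψ p * Ψ w = -(Ψ w * Ψ p) at hEF
  have hFE : Ψ w * Ψ p = -(Ψ p * Ψ w) := by rw [hEF, neg_neg]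
  have h2M : IsUnit (2 : Matrix (Fin 2) (Fin 2) L) := by
    have := (h2.isUnit).map (algebraMap L (Matrix (Fin 2) (Fin 2) L))
    rwa [map_ofNat] at this
  have hne := one_add_letter_ne_zero h2M hE hF hEF
  set E := letter (Ψ p) (Ψ w) with hEdef
  let r := letter p w
  have hr : ∀ c, Ψ (r c) = E c := map_letter Ψ p w
  have hadj : ∀ c, (1 - E c).adjugate = 1 + E c := by
    rintro ⟨_ | _, _ | _⟩ <;> simp only [hEdef, letter, cond_true, cond_false]
    · exact adjugate_one_sub_eq h2 hE (by rw [neg_mul, hFE, mul_neg])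
    · exact adjugate_one_sub_eq h2 hE hFE
    · exact adjugate_one_sub_eq h2 hF (by rw [neg_mul, hEF, mul_neg])
    · exact adjugate_one_sub_eq h2 hF hEF
  have hrneg : ∀ c, r (c.1, !c.2) = -r c := by
    rintro ⟨_ | _, _ | _⟩ <;> simp [r, letter]
  have hEneg : ∀ c, E (c.1, !c.2) = -E c := fun c => by rw [← hr, hrneg, map_neg, hr]
  have hgen : ∀ c, gen k (1 - r c) ≠ 0 := fun c h0 => hne (c.1, !c.2) <| by
    rw [hEneg, ← hr, ← sub_eq_add_neg, ← map_one Ψ, ← map_sub]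
    change ev.mapMatrix (gen k (1 - r c)) = 0
    rw [h0, map_zero]
  have hφne : ∀ c, φ (1 - r c) ≠ 0 := fun c h0 =>
    hgen c (by rw [hφ (h0.trans (map_zero φ).symm), map_zero])
  have hφne' : ∀ c, φ (1 + r c) ≠ 0 := fun c => by
    have := hφne (c.1, !c.2)
    rwa [hrneg, sub_neg_eq_add] at this
  let d : Bool × Bool → D := fun c => φ (1 + r c) * (φ (1 - r c))⁻¹
  let N := fun c => gen k (1 + r c) * (gen k (1 - r c)).adjugate
  let n := fun c => (1 + E c) * (1 + E c)
  have hdN : ∀ c, Specializes φ (d c) (N c) := fun c => specializes_cayley hφ (hgen c)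
  have hNn : ∀ c, ev.mapMatrix (N c) = n c := fun c => by
    have h1 : ev.mapMatrix (gen k (1 + r c)) = 1 + E c := by
      rw [← hr, ← map_one Ψ, ← map_add]; rfl
    have h3 : ev.mapMatrix (gen k (1 - r c)) = 1 - E c := by
      rw [← hr, ← map_one Ψ, ← map_sub]; rfl
    rw [map_mul, RingHom.map_adjugate, h1, h3, hadj]
  have hn0 : ∀ c, n c ≠ 0 := fun c h0 => hne c <| by
    have : n c = 2 * (1 + E c) := one_add_mul_one_add (letter_mul_self hE hF c)
    rwa [this, h2M.mul_right_eq_zero] at h0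
  have hninv : ∀ c, n (c.1, !c.2) * n c = 0 := fun c => by
    have : (1 + -E c) * (1 + E c) = 0 := by
      have : E c * E c = 1 := letter_mul_self hE hF c
      rw [add_mul, one_mul, neg_mul, mul_add, mul_one, this]
      abel
    simp only [n, hEneg]
    rw [mul_assoc, ← mul_assoc (1 + -E c) (1 + E c), this, zero_mul, mul_zero]
  have hlist : ∀ l : List (Bool × Bool), Specializes φ (l.map d).prod (l.map N).prod := by
    intro l
    induction l with
    | nil => exact Specializes.one
    | cons a l ih => simpa using (hdN a).mul hφ hquot ih
  have hdne : ∀ c, d c ≠ 0 := fun c => mul_ne_zero (hφne' c) (inv_ne_zero (hφne c))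
  have hcomm : ∀ c, Commute (φ (1 - r c)) (φ (1 + r c)) := fun c => by
    have : Commute (1 - r c) (1 + r c) :=
      ((Commute.one_left _).sub_left ((Commute.one_right _).add_right (Commute.refl _)))
    exact this.map φ
  have hdinv : ∀ c, (d c)⁻¹ = d (c.1, !c.2) := fun c => by
    simp only [d, hrneg, sub_neg_eq_add, ← sub_eq_add_neg]
    rw [_root_.mul_inv_rev, inv_inv, (hcomm c).inv_right₀.eq]
  have hinvol_one : invol 1 = 1 := by
    have := hinvol_mul (invol 1) 1
    rwa [mul_one, hinvol_invol, mul_one, eq_comm] at this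
  have hsymm : ∀ c, invol (d c) = d c := fun c => by
    have hrc : invol (φ (r c)) = φ (r c) := by
      rcases c with ⟨_ | _, _ | _⟩ <;> simp [r, letter, hp, hw]
    have h1 : invol (φ (1 - r c)) = φ (1 - r c) := by simp [hinvol_one, hrc]
    have h3 : invol (φ (1 + r c)) = φ (1 + r c) := by simp [hinvol_one, hrc]
    have h4 : invol (d c * φ (1 - r c)) = φ (1 + r c) := by
      rw [inv_mul_cancel_right₀ (hφne c), h3]
    rw [hinvol_mul, h1] at h4
    refine mul_left_cancel₀ (hφne c) (h4.trans ?_)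
    rw [← mul_assoc, (hcomm c).eq, mul_inv_cancel_right₀ (hφne c)]
  refine ⟨Units.mk0 (d (true, true)) (hdne _), Units.mk0 (d (false, true)) (hdne _), ?_,
    hsymm _, hsymm _⟩
  rw [IsFreePair, injective_iff_map_eq_one]
  intro g hg
  by_contra hg1
  have hword : (g.toWord.map d).prod = 1 := by
    have h5 := congrArg (Units.coeHom D) hg
    rw [← FreeGroup.mk_toWord (x := g), FreeGroup.lift_mk, map_list_prod, List.map_map,
      map_one] at h5
    rw [← h5]
    congr 1
    refine List.map_congr_left fun c _ => ?_
    rcases c with ⟨_ | _, _ | _⟩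
    · simpa using (hdinv (false, true)).symm
    · simp
    · simpa using (hdinv (true, true)).symm
    · simp
  have hspec := hlist g.toWord
  rw [hword] at hspec
  obtain ⟨c, hc⟩ := hspec.exists_eq_smul_one hφ
  have hmap : (g.toWord.map n).prod = ev c • (1 : Matrix (Fin 2) (Fin 2) L) := by
    have h6 := congrArg ev.mapMatrix hc
    rw [map_list_prod, List.map_map, funext (f := ev.mapMatrix ∘ N) (g := n) hNn] at h6
    rw [h6, smul_one_eq_diagonal, smul_one_eq_diagonal, RingHom.mapMatrix_apply,
      diagonal_map (map_zero ev)]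
  have hne0 : (g.toWord.map n).prod ≠ 0 :=
    prod_map_ne_zero_of_isChain hn0 (fun a b h => exists_sandwich_eq_smul h2 hE hF hEF h) _
      (by simpa using hg1) FreeGroup.isReduced_toWord
  cases hl : g.toWord with
  | nil => exact hg1 (FreeGroup.toWord_eq_nil_iff.1 hl)
  | cons a l =>
    apply hne0
    have h7 : ev c • n (a.1, !a.2) = 0 := by
      have := congrArg (n (a.1, !a.2) * ·) hmap
      simp only [hl, List.map_cons, List.prod_cons, ← mul_assoc, hninv, zero_mul,
        Matrix.mul_smul, mul_one] at this
      exact this.symm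
    rw [hmap, (smul_eq_zero.1 h7).resolve_right (hn0 _), zero_smul]

end free

section evaluation

variable {k : Type*} [Field k] {L : Type*} [Field L] [Algebra k L]

/-- The character `(i, j) ↦ t ^ i * s ^ j`. -/
def powChar (t s : Lˣ) : Multiplicative (ℤ × ℤ) →* L where
  toFun a := (t ^ a.toAdd.1 * s ^ a.toAdd.2 : Lˣ)
  map_one' := by simp
  map_mul' a b := by
    rw [← Units.val_mul]
    congr 1
    simp only [toAdd_mul, Prod.fst_add, Prod.snd_add, zpow_add]
    exact mul_mul_mul_comm _ _ _ _

lemma powChar_apply (t s : Lˣ) (i j : ℤ) :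
    powChar t s (.ofAdd (i, j)) = (t ^ i * s ^ j : Lˣ) := rfl

variable (k) in
lemma exists_map_gen_single_eq_rep (χ : Multiplicative (ℤ × ℤ) →* L) :
    ∃ ev : AddMonoidAlgebra k (ℤ × ℤ) →+* L,
      ∀ g, (gen k (MonoidAlgebra.single g 1)).map ev = rep χ g := by
  refine ⟨AddMonoidAlgebra.lift k L (ℤ × ℤ) χ, fun g => ?_⟩
  have hχ : ((AddMonoidAlgebra.lift k L (ℤ × ℤ) χ : AddMonoidAlgebra k (ℤ × ℤ) →+* L) :
      AddMonoidAlgebra k (ℤ × ℤ) →* L).comp (AddMonoidAlgebra.of k (ℤ × ℤ)) = χ := by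
    ext a
    simp
  rw [gen_single, one_smul, rep_map, hχ]

lemma rep_z (χ : Multiplicative (ℤ × ℤ) →* L) (m : ℤ) : rep χ (z ^ m) = sgn L m • 1 := by
  have : χ (.ofAdd ((0 : ℤ), (0 : ℤ))) = 1 := map_one χ
  simp [rep_apply, z_zpow, this, Matrix.one_fin_two]

lemma rep_mul_self (t s : Lˣ) (p q : ℤ) :
    rep (powChar t s) ⟨p, q, 0⟩ * rep (powChar t s) ⟨p, q, 0⟩ =
      (sgn L (p * q) * ((t ^ p * s ^ q : Lˣ) : L) ^ 2) • 1 := by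
  rw [← map_mul, rep_apply]
  have h1 : sgn L (p + p) = 1 := sgn_of_even ⟨p, rfl⟩
  have h2 : (t ^ (p + p) * s ^ (q + q) : Lˣ) = (t ^ p * s ^ q) ^ 2 := by
    rw [zpow_add, zpow_add, mul_mul_mul_comm, sq]
  have h3 : Even (q + q) := ⟨q, rfl⟩
  simp only [mul_i, mul_j, mul_l, h1, powChar_apply, h2, h3, if_true, Units.val_pow_eq_pow_val]
  rw [← Matrix.one_fin_two, zero_add, zero_sub, sgn_neg, mul_comm q p]

end evaluation

lemma exists_root_ne_zero {L : Type*} [Field L] [IsAlgClosed L] (b : L) {c : L} (hc : c ≠ 0) :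
    ∃ x : Lˣ, (x : L) ^ 2 + b * x + c = 0 := by
  open Polynomial in
  have hd : (C (1 : L) * X ^ 2 + C b * X + C c).degree ≠ 0 := by
    rw [degree_quadratic one_ne_zero]; decide
  obtain ⟨x, hx⟩ := IsAlgClosed.exists_root _ hd
  simp only [map_one, one_mul, Polynomial.IsRoot.def, Polynomial.eval_add, Polynomial.eval_mul,
    Polynomial.eval_pow, Polynomial.eval_X, Polynomial.eval_C] at hx
  refine ⟨Units.mk0 x ?_, hx⟩
  rintro rfl
  exact hc (by simpa using hx)

section anticommuting

variable {L M : Type*} [Field L] [Ring M] [Algebra L M] {G H H' : M} {η δ : L}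

lemma add_mul_self_of_smul (hη : η ≠ 0) (hδ : δ * δ = 1) (hGH : G * H = -(H * G))
    (hHH : H * H = η • 1) (h : η ^ 2 + (2 * δ - 1) * η + 1 = 0) (hH : H * H' = δ • 1) :
    (H + H') * (H + H') = 1 ∧ G * (H + H') = -((H + H') * G) := by
  have hH' : H' = (η⁻¹ * δ) • H := by
    have := congrArg (fun t => η⁻¹ • (H * t)) hH
    simpa [← mul_assoc, hHH, smul_smul, hη] using this
  have hs : H + H' = (1 + η⁻¹ * δ) • H := by rw [hH', add_smul, one_smul]
  rw [hs, smul_mul_smul_comm, hHH, smul_smul, mul_smul_comm, smul_mul_assoc, hGH, smul_neg]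
  refine ⟨?_, rfl⟩
  convert one_smul L (1 : M)
  field_simp
  linear_combination h + hδ

lemma add_mul_self_of_smul_mul (hη : η ≠ 0) (hδ : δ * δ = 1) (hGG : G * G = 1)
    (hGH : G * H = -(H * G)) (hHH : H * H = η • 1) (h : η ^ 2 - η - 1 = 0)
    (hH : H * H' = δ • G) :
    (H + H') * (H + H') = 1 ∧ G * (H + H') = -((H + H') * G) := by
  have hH' : H' = (η⁻¹ * δ) • (H * G) := by
    have := congrArg (fun t => η⁻¹ • (H * t)) hH
    simpa [← mul_assoc, hHH, smul_smul, hη] using this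
  have h1 : H * (H * G) = η • G := by rw [← mul_assoc, hHH, smul_one_mul]
  have h2 : H * G * H = -(η • G) := by rw [mul_assoc, hGH, mul_neg, h1]
  have h3 : H * G * (H * G) = -(η • 1) := by rw [← mul_assoc, h2, neg_mul, smul_mul_assoc, hGG]
  have h4 : G * (H * G) = -H := by rw [← mul_assoc, hGH, neg_mul, mul_assoc, hGG, mul_one]
  constructor
  · rw [hH', mul_add, add_mul, add_mul, smul_mul_smul_comm, smul_mul_assoc, mul_smul_comm, hHH, h1,
      h2, h3, smul_neg, add_comm (_ • _ • G), add_assoc, neg_add_cancel_comm_assoc,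
      smul_neg, smul_smul, ← neg_smul, ← add_smul]
    convert one_smul L (1 : M)
    field_simp
    linear_combination h - hδ
  · rw [hH', mul_add, add_mul, mul_smul_comm, smul_mul_assoc, mul_assoc H, hGG, h4, hGH, mul_one,
      smul_neg, neg_add]

end anticommuting

lemma toAdd_hom_apply (f : HeisCoord →* Multiplicative ℤ) (g : HeisCoord) :
    (f g).toAdd = g.i * (f x).toAdd + g.j * (f y).toAdd := by
  have hz : f z = 1 := by
    have h : x * y = y * x * z := by ext <;> simp [x, y, z]
    have := congrArg f h
    rwa [map_mul, map_mul, map_mul, mul_comm (f y), left_eq_mul] at this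
  conv_lhs => rw [eq_zpow g]
  simp [hz]

/-- The first coordinate as a homomorphism. -/
def iHom : HeisCoord →* Multiplicative ℤ where
  toFun g := .ofAdd g.i
  map_one' := rfl
  map_mul' _ _ := rfl

/-- The second coordinate as a homomorphism. -/
def jHom : HeisCoord →* Multiplicative ℤ where
  toFun g := .ofAdd g.j
  map_one' := rfl
  map_mul' _ _ := rfl

lemma zpow_i (g : HeisCoord) (n : ℤ) : (g ^ n).i = n * g.i := by
  simpa [iHom] using congrArg Multiplicative.toAdd (map_zpow iHom g n)

lemma zpow_j (g : HeisCoord) (n : ℤ) : (g ^ n).j = n * g.j := by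
  simpa [jHom] using congrArg Multiplicative.toAdd (map_zpow jHom g n)

lemma exists_eq_mul_z_zpow {g h : HeisCoord} (hi : g.i = h.i) (hj : g.j = h.j) :
    ∃ m : ℤ, g = h * z ^ m := by
  refine ⟨g.l - h.l, ?_⟩
  ext <;> simp [z_zpow, hi, hj]

lemma exists_fixed_vector {a b c : ℤ} (h : a ^ 2 + b * c = 1) :
    ∃ p q r s : ℤ, p * s - q * r = 1 ∧ a * p + b * q = p ∧ c * p - a * q = q := by
  obtain ⟨u, v, huv, h1, h2⟩ : ∃ u v : ℤ, (u ≠ 0 ∨ v ≠ 0) ∧ a * u + b * v = u ∧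
      c * u - a * v = v := by
    by_cases h0 : 1 + a = 0 ∧ c = 0
    · refine ⟨b, 2, .inr two_ne_zero, ?_, ?_⟩
      · linear_combination b * h0.1
      · linear_combination b * h0.2 - 2 * h0.1
    · refine ⟨1 + a, c, by tauto, ?_, ?_⟩
      · linear_combination h
      · ring
  obtain ⟨p, q, hpq, hu, hv⟩ := Int.exists_gcd_one (Int.gcd_pos_iff.2 huv)
  have hd : (Int.gcd u v : ℤ) ≠ 0 := by exact_mod_cast (Int.gcd_pos_iff.2 huv).ne'
  generalize (Int.gcd u v : ℤ) = n at hu hv hd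
  subst hu hv
  obtain ⟨s, r, hrs⟩ := Int.isCoprime_iff_gcd_eq_one.2 hpq
  refine ⟨p, q, -r, s, by linear_combination hrs, ?_, ?_⟩
  · apply mul_right_cancel₀ hd; linear_combination h1
  · apply mul_right_cancel₀ hd; linear_combination h2

section star

variable {star : HeisCoord → HeisCoord} (hmul : ∀ g h, star (g * h) = star h * star g)
  (hinv : ∀ g, star (star g) = g)

include hmul in
lemma star_one : star 1 = 1 := by
  have := hmul 1 1
  rwa [mul_one, left_eq_mul] at this

include hmul in
lemma star_zpow (g : HeisCoord) (n : ℤ) : star (g ^ n) = star g ^ n := by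
  let F : HeisCoord →* HeisCoordᵐᵒᵖ :=
    { toFun := fun g => .op (star g)
      map_one' := by rw [star_one hmul]; rfl
      map_mul' := fun g h => by rw [hmul]; rfl }
  exact congrArg MulOpposite.unop (map_zpow F g n)

include hmul in
lemma star_coord (g : HeisCoord) : (star g).i = g.i * (star x).i + g.j * (star y).i ∧
    (star g).j = g.i * (star x).j + g.j * (star y).j := by
  let fi : HeisCoord →* Multiplicative ℤ :=
    { toFun := fun g => .ofAdd (star g).i
      map_one' := by rw [star_one hmul]; rfl
      map_mul' := fun g h => by rw [hmul, mul_i, add_comm]; rfl }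
  let fj : HeisCoord →* Multiplicative ℤ :=
    { toFun := fun g => .ofAdd (star g).j
      map_one' := by rw [star_one hmul]; rfl
      map_mul' := fun g h => by rw [hmul, mul_j, add_comm]; rfl }
  exact ⟨toAdd_hom_apply fi g, toAdd_hom_apply fj g⟩

include hmul in
lemma star_z : star z = ⟨0, 0, (star x).j * (star y).i - (star y).j * (star x).i⟩ := by
  obtain ⟨hi, hj⟩ := star_coord hmul z
  have h : x * y = y * x * z := by ext <;> simp [x, y, z]
  have hl := congrArg (fun g => (star g).l) h
  simp only [hmul, mul_l, mul_i] at hl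
  ext
  · simpa [z] using hi
  · simpa [z] using hj
  · simp only [z] at hi hj hl ⊢
    rw [hj] at hl
    linear_combination -hl

include hmul hinv in
lemma star_cases (hnot : ¬ ∃ m n : ℤ, star x = z ^ m * x ∧ star y = z ^ n * y) :
    (∃ e f : ℤ, star x = ⟨-1, 0, e⟩ ∧ star y = ⟨0, -1, f⟩) ∨
    ∃ g h : HeisCoord, star g = g ∧ g.l = 0 ∧ h.l = 0 ∧ g.i * h.j - g.j * h.i = 1 ∧
      ∃ n m : ℤ, h * star h = g ^ n * z ^ m := by
  obtain ⟨hxi, hxj⟩ := star_coord hmul (star x)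
  obtain ⟨hyi, hyj⟩ := star_coord hmul (star y)
  rw [hinv] at hxi hxj hyi hyj
  have hco := star_coord hmul
  have hz := star_z hmul
  simp only [show x.i = 1 from rfl, show x.j = 0 from rfl] at hxi hxj
  simp only [show y.i = 0 from rfl, show y.j = 1 from rfl] at hyi hyj
  generalize ha : (star x).i = a at *
  generalize hc : (star x).j = c at *
  generalize hb : (star y).i = b at *
  generalize hd : (star y).j = d at *
  by_cases htr : a + d = 0
  · right
    obtain rfl : d = -a := by linear_combination htr
    obtain ⟨p, q, r, s, hdet, hp, hq⟩ := exists_fixed_vector (a := a) (b := b) (c := c)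
      (by linear_combination -hxi)
    have hzz : star z = z := by
      rw [hz]
      ext
      · rfl
      · rfl
      · change c * b - -a * a = 1
        linear_combination -hxi
    refine ⟨⟨p, q, 0⟩, ⟨r, s, 0⟩, ?_, rfl, rfl, hdet, ?_⟩
    · obtain ⟨m, hm⟩ := exists_eq_mul_z_zpow (g := star ⟨p, q, 0⟩) (h := ⟨p, q, 0⟩)
        (by rw [(hco _).1]; linear_combination hp) (by rw [(hco _).2]; linear_combination hq)
      have hzm : star (z ^ m) = z ^ m := by rw [star_zpow hmul, hzz]
      have h2 := congrArg star hm
      rw [hinv, hmul, hzm, hm] at h2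
      have := congrArg HeisCoord.l h2
      simp [z_zpow] at this
      have hm0 : m = 0 := by omega
      rw [hm, hm0, zpow_zero, mul_one]
    · refine ⟨s * (r + (r * a + s * b)) - r * (s + (r * c + s * -a)), ?_⟩
      apply exists_eq_mul_z_zpow
      · rw [zpow_i, mul_i, (hco _).1]
        linear_combination -(r + (r * a + s * b)) * hdet + r * (r * hq - s * hp)
      · rw [zpow_j, mul_j, (hco _).2]
        linear_combination -(s + (r * c + s * -a)) * hdet + s * (r * hq - s * hp)
  · left
    have hc0 : c = 0 :=
      (mul_eq_zero.1 (by linear_combination -hxj : c * (a + d) = 0)).resolve_right htr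
    have hb0 : b = 0 :=
      (mul_eq_zero.1 (by linear_combination -hyi : b * (a + d) = 0)).resolve_right htr
    subst hc0 hb0
    have ha1 : a = 1 ∨ a = -1 := mul_self_eq_one_iff.1 (by linear_combination -hxi)
    have hd1 : d = 1 ∨ d = -1 := mul_self_eq_one_iff.1 (by linear_combination -hyj)
    have had : a = 1 ∧ d = 1 ∨ a = -1 ∧ d = -1 := by omega
    rcases had with ⟨rfl, rfl⟩ | ⟨rfl, rfl⟩
    · refine (hnot ?_).elim
      obtain ⟨m, hm⟩ := exists_eq_mul_z_zpow (g := star x) (h := x) ha hc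
      obtain ⟨n, hn⟩ := exists_eq_mul_z_zpow (g := star y) (h := y) hb hd
      have hcomm : ∀ (g : HeisCoord) (m : ℤ), g * z ^ m = z ^ m * g := fun g m =>
        ((show Commute z g from z_mul_comm g).zpow_left m).eq.symm
      exact ⟨m, n, hm.trans (hcomm _ _), hn.trans (hcomm _ _)⟩
    · exact ⟨(star x).l, (star y).l, HeisCoord.ext ha hc rfl, HeisCoord.ext hb hd rfl⟩

end star

section main

variable {k : Type*} [Field k]

lemma rep_even_zpow {L : Type*} [Field L] {χ : Multiplicative (ℤ × ℤ) →* L} {g : HeisCoord}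
    (h : rep χ g * rep χ g = 1) {n : ℤ} (hn : Even n) : rep χ (g ^ n) = 1 := by
  obtain ⟨m, rfl⟩ := hn
  rw [← map_mul] at h
  have : (g * g) ^ m ∈ (rep χ).ker := zpow_mem (MonoidHom.mem_ker.2 h) m
  rwa [MonoidHom.mem_ker, (Commute.refl g).mul_zpow, ← zpow_add] at this

lemma exists_units_zpow_mul_zpow_eq {L : Type*} [Field L] {p q r s : ℤ} (h : p * s - q * r = 1)
    (τ σ : Lˣ) : ∃ t u : Lˣ, t ^ p * u ^ q = τ ∧ t ^ r * u ^ s = σ := by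
  refine ⟨τ ^ s * σ ^ (-q), τ ^ (-r) * σ ^ p, ?_, ?_⟩ <;>
    rw [mul_zpow, mul_zpow, mul_mul_mul_comm] <;> simp only [← zpow_mul, ← zpow_add]
  · rw [show s * p + -r * q = 1 by linear_combination h, show -q * p + p * q = 0 by ring]
    simp
  · rw [show s * r + -r * s = 0 by ring, show -q * r + p * s = 1 by linear_combination h]
    simp

lemma diag_mul_self {B : Type*} [CommRing B] :
    (!![1, 0; 0, -1] : Matrix (Fin 2) (Fin 2) B) * !![1, 0; 0, -1] = 1 := by
  simp [Matrix.one_fin_two]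

lemma swap_mul_self {B : Type*} [CommRing B] :
    (!![0, 1; 1, 0] : Matrix (Fin 2) (Fin 2) B) * !![0, 1; 1, 0] = 1 := by
  simp [Matrix.one_fin_two]

lemma diag_mul_swap {B : Type*} [CommRing B] :
    (!![1, 0; 0, -1] : Matrix (Fin 2) (Fin 2) B) * !![0, 1; 1, 0] =
      -(!![0, 1; 1, 0] * !![1, 0; 0, -1]) := by
  simp

lemma add_mul_inv_eq_one {L : Type*} [Field L] {t : Lˣ} {c : L}
    (h : (t : L) ^ 2 + -1 * t + c = 0) : (t : L) + c * (t : L)⁻¹ = 1 := by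
  have := t.ne_zero
  field_simp
  linear_combination h

variable {D : Type*} [DivisionRing D] [Algebra k D] {φ : MonoidAlgebra k HeisCoord →ₐ[k] D}

theorem exists_free_symmetric_pair_of_star (h2k : (2 : k) ≠ 0) (hφ : Function.Injective φ)
    (hquot : ∀ d : D, ∃ a b : MonoidAlgebra k HeisCoord, φ b ≠ 0 ∧ d = φ a * (φ b)⁻¹)
    {star : HeisCoord → HeisCoord} (hmul : ∀ g h, star (g * h) = star h * star g)
    (hinv : ∀ g, star (star g) = g)
    (invol : D →ₗ[k] D) (hinvol_mul : ∀ c d : D, invol (c * d) = invol d * invol c)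
    (hinvol_invol : ∀ c : D, invol (invol c) = c)
    (hinduced : ∀ g, invol (φ (MonoidAlgebra.single g 1)) = φ (MonoidAlgebra.single (star g) 1))
    (hnot : ¬ ∃ m n : ℤ, star x = z ^ m * x ∧ star y = z ^ n * y) :
    ∃ u v : Dˣ, IsFreePair u v ∧ invol (u : D) = (u : D) ∧ invol (v : D) = (v : D) := by
  let L := AlgebraicClosure k
  have h2 : (2 : L) ≠ 0 := by
    have := (map_ne_zero (algebraMap k L)).2 h2k
    rwa [map_ofNat] at this
  have hsgn : ∀ n : ℤ, sgn L n ≠ 0 := sgn_ne_zero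
  have hsum : ∀ g, invol (φ (MonoidAlgebra.single g 1 + MonoidAlgebra.single (star g) 1)) =
      φ (MonoidAlgebra.single g 1 + MonoidAlgebra.single (star g) 1) := fun g => by
    rw [map_add, map_add, hinduced, hinduced, hinv, add_comm]
  rcases star_cases hmul hinv hnot with ⟨e, f, hx, hy⟩ | ⟨g, h, hg, hgl, hhl, hdet, n, m, hn⟩
  · obtain ⟨t, ht⟩ := exists_root_ne_zero (-1 : L) (hsgn e)
    obtain ⟨s, hs⟩ := exists_root_ne_zero (-1 : L) (hsgn f)
    obtain ⟨ev, hev⟩ := exists_map_gen_single_eq_rep k (powChar t s)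
    have ht' : (t : L) + sgn L e * (t : L)⁻¹ = 1 := add_mul_inv_eq_one ht
    have hs' : (s : L) + sgn L f * (s : L)⁻¹ = 1 := add_mul_inv_eq_one hs
    have hE : (gen k (MonoidAlgebra.single x 1 + MonoidAlgebra.single (star x) 1)).map ev =
        !![1, 0; 0, -1] := by
      rw [map_add, Matrix.map_add _ (map_add ev), hev, hev, hx, rep_apply, rep_apply]
      ext i j
      fin_cases i <;> fin_cases j <;> simp [x, powChar_apply, sgn_neg]
      · exact ht'
      · linear_combination -ht'
    have hF : (gen k (MonoidAlgebra.single y 1 + MonoidAlgebra.single (star y) 1)).map ev =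
        !![0, 1; 1, 0] := by
      rw [map_add, Matrix.map_add _ (map_add ev), hev, hev, hy, rep_apply, rep_apply]
      ext i j
      fin_cases i <;> fin_cases j <;> simp [y, powChar_apply]
      · exact hs'
      · exact hs'
    refine exists_free_symmetric_pair hφ hquot invol hinvol_mul hinvol_invol (hsum x) (hsum y) h2
      ev ?_ ?_ ?_
    · rw [hE]; exact diag_mul_self
    · rw [hF]; exact swap_mul_self
    · rw [hE, hF]; exact diag_mul_swap
  · obtain ⟨p, q, l⟩ := g
    obtain ⟨r, s, l'⟩ := h
    obtain rfl : l = 0 := hgl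
    obtain rfl : l' = 0 := hhl
    obtain ⟨τ, hτ⟩ := exists_root_ne_zero (0 : L) (neg_ne_zero.2 (hsgn (p * q)))
    obtain ⟨η, hη⟩ : ∃ η : Lˣ, if Even n then (η : L) ^ 2 + (2 * sgn L m - 1) * η + 1 = 0 else
        (η : L) ^ 2 - η - 1 = 0 := by
      split_ifs
      · exact exists_root_ne_zero _ one_ne_zero
      · obtain ⟨η, hη⟩ := exists_root_ne_zero (-1 : L) (c := -1) (by simp)
        exact ⟨η, by linear_combination hη⟩
    obtain ⟨σ, hσ⟩ := exists_root_ne_zero (0 : L)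
      (neg_ne_zero.2 (mul_ne_zero (hsgn (r * s)) η.ne_zero))
    obtain ⟨t, u, htu, htu'⟩ := exists_units_zpow_mul_zpow_eq hdet τ σ
    obtain ⟨ev, hev⟩ := exists_map_gen_single_eq_rep k (powChar t u)
    have hGG : rep (powChar t u) ⟨p, q, 0⟩ * rep (powChar t u) ⟨p, q, 0⟩ = 1 := by
      rw [rep_mul_self, htu]
      convert one_smul L (1 : Matrix (Fin 2) (Fin 2) L)
      linear_combination sgn L (p * q) * hτ + sgn_mul_self (B := L) (p * q)
    have hHH : rep (powChar t u) ⟨r, s, 0⟩ * rep (powChar t u) ⟨r, s, 0⟩ = (η : L) • 1 := by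
      rw [rep_mul_self, htu']
      congr 1
      linear_combination sgn L (r * s) * hσ + η * sgn_mul_self (B := L) (r * s)
    have hGH : rep (powChar t u) ⟨p, q, 0⟩ * rep (powChar t u) ⟨r, s, 0⟩ =
        -(rep (powChar t u) ⟨r, s, 0⟩ * rep (powChar t u) ⟨p, q, 0⟩) := by
      have hgh : (⟨p, q, 0⟩ : HeisCoord) * ⟨r, s, 0⟩ = ⟨r, s, 0⟩ * ⟨p, q, 0⟩ * z ^ (1 : ℤ) := by
        ext
        · simp [z, add_comm]
        · simp [z, add_comm]
        · simp only [mul_l, mul_j, z_zpow]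
          linear_combination hdet
      rw [← map_mul, hgh, map_mul, map_mul, rep_z]
      simp
    have hH : rep (powChar t u) ⟨r, s, 0⟩ * rep (powChar t u) (star ⟨r, s, 0⟩) =
        sgn L m • rep (powChar t u) (⟨p, q, 0⟩ ^ n) := by
      rw [← map_mul, hn, map_mul, rep_z, mul_smul_comm, mul_one]
    have key : (rep (powChar t u) ⟨r, s, 0⟩ + rep (powChar t u) (star ⟨r, s, 0⟩)) *
        (rep (powChar t u) ⟨r, s, 0⟩ + rep (powChar t u) (star ⟨r, s, 0⟩)) = 1 ∧
        rep (powChar t u) ⟨p, q, 0⟩ *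
          (rep (powChar t u) ⟨r, s, 0⟩ + rep (powChar t u) (star ⟨r, s, 0⟩)) =
        -((rep (powChar t u) ⟨r, s, 0⟩ + rep (powChar t u) (star ⟨r, s, 0⟩)) *
          rep (powChar t u) ⟨p, q, 0⟩) := by
      split_ifs at hη with hpar
      · rw [rep_even_zpow hGG hpar] at hH
        exact add_mul_self_of_smul η.ne_zero (sgn_mul_self m) hGH hHH hη hH
      · obtain ⟨i, rfl⟩ := Int.not_even_iff_odd.1 hpar
        rw [zpow_add_one, map_mul, rep_even_zpow hGG ⟨i, two_mul i⟩, one_mul] at hH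
        exact add_mul_self_of_smul_mul η.ne_zero (sgn_mul_self m) hGG hGH hHH hη hH
    refine exists_free_symmetric_pair hφ hquot invol hinvol_mul hinvol_invol
      (p := MonoidAlgebra.single ⟨p, q, 0⟩ 1) (by rw [hinduced, hg]) (hsum ⟨r, s, 0⟩) h2 ev ?_ ?_ ?_
    · rwa [hev]
    · rw [map_add, Matrix.map_add _ (map_add ev), hev, hev]
      exact key.1
    · rw [map_add, Matrix.map_add _ (map_add ev), hev, hev, hev]
      exact key.2

end main

end HeisCoord

theorem free_symmetric_pair_heisenberg_not_type_I
    (k : Type*) [Field k] (hchar : ringChar k ≠ 2)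
    (D : Type*) [DivisionRing D] [Algebra k D]
    (φ : MonoidAlgebra k Heisenberg →ₐ[k] D)
    (hφinj : Function.Injective φ)
    (hquot : ∀ d : D, ∃ a b : MonoidAlgebra k Heisenberg, φ b ≠ 0 ∧ d = φ a * (φ b)⁻¹)
    (gstar : Heisenberg → Heisenberg)
    (hgstar_mul : ∀ g h : Heisenberg, gstar (g * h) = gstar h * gstar g)
    (hgstar_invol : ∀ g : Heisenberg, gstar (gstar g) = g)
    (invol : D →ₗ[k] D)
    (hinvol_mul : ∀ c d : D, invol (c * d) = invol d * invol c)
    (hinvol_invol : ∀ c : D, invol (invol c) = c)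
    (hinduced : ∀ g : Heisenberg,
      invol (φ (MonoidAlgebra.of k Heisenberg g)) = φ (MonoidAlgebra.of k Heisenberg (gstar g)))
    (hnotI : ¬ ∃ m n : ℤ, gstar Hx = Hlam ^ m * Hx ∧ gstar Hy = Hlam ^ n * Hy) :
    ∃ u v : Dˣ, IsFreePair u v ∧ invol (u : D) = (u : D) ∧ invol (v : D) = (v : D) := by
  classical
  let e := MonoidAlgebra.domCongr k k heisEquiv.symm
  refine HeisCoord.exists_free_symmetric_pair_of_star
    (φ := φ.comp (e : MonoidAlgebra k HeisCoord →ₐ[k] MonoidAlgebra k Heisenberg))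
    (star := fun g => heisEquiv (gstar (heisEquiv.symm g))) (Ring.two_ne_zero hchar)
    (hφinj.comp e.injective) (fun d => ?_) (fun g h => ?_) (fun g => ?_) invol hinvol_mul
    hinvol_invol (fun g => ?_) ?_
  · obtain ⟨a, b, hb, hd⟩ := hquot d
    exact ⟨e.symm a, e.symm b, by simpa using hb, by simpa using hd⟩
  · rw [map_mul, hgstar_mul, map_mul]
  · simp [hgstar_invol]
  · have := hinduced (heisEquiv.symm g)
    simpa [e] using this
  · rintro ⟨m, n, hx, hy⟩
    refine hnotI ⟨m, n, heisEquiv.injective ?_, heisEquiv.injective ?_⟩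
    · rw [map_mul, map_zpow, heisEquiv_Hlam, heisEquiv_Hx, ← hx, ← heisEquiv_Hx,
        heisEquiv.symm_apply_apply]
    · rw [map_mul, map_zpow, heisEquiv_Hlam, heisEquiv_Hy, ← hy, ← heisEquiv_Hy,
        heisEquiv.symm_apply_apply]
end

section
/- Let k be a field of characteristic different from 2, let D (with embedding φ : kΓ → D) be a division ring of quotients of the group algebra kΓ of the Heisenberg group Γ, and let * be a k-involution on D induced by an involution ⋆ on Γ. Suppose there exist integers m, n such that x⋆ = λ^m·x and y⋆ = λ^n·y, and suppose that m and n are not both odd. Then the multiplicative group D^× contains a free symmetric pair. -/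
universe u

theorem Hx_mul_Hy : Hx * Hy = Hlam * (Hy * Hx) ∧ ∀ g, Commute Hlam g := by
  have hc : ∀ {G : Type} [Group G] {g h : G}, commS g h = 1 → Commute g h := by
    intro G _ g h e
    have e' : (h * g)⁻¹ * (g * h) = 1 := by simpa [commS, mul_assoc] using e
    exact (inv_mul_eq_one.mp e').symm
  have h0 : Commute Hlam Hx := hc (PresentedGroup.one_of_mem (rels := heisRels) (Or.inl rfl))
  have h1 : Commute Hlam Hy := hc (PresentedGroup.one_of_mem (rels := heisRels) (Or.inr rfl))
  refine ⟨?_, fun g => ?_⟩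
  · rw [((h1.mul_right h0)).eq, Hlam, commS]
    group
  · have := PresentedGroup.generated_by heisRels (Subgroup.centralizer {Hlam}) (by
      intro j
      rw [Subgroup.mem_centralizer_singleton_iff]
      fin_cases j
      · exact h0.eq.symm
      · exact h1.eq.symm) g
    rw [Subgroup.mem_centralizer_singleton_iff] at this
    exact this.symm

theorem Heisenberg.exists_swap (g h : Heisenberg) :
    ∃ z ∈ Subgroup.center Heisenberg, g * h = h * g * z := by
  have hlam : Hlam ∈ Subgroup.center Heisenberg :=
    Subgroup.mem_center_iff.mpr fun g => ((Hx_mul_Hy.2 g).eq).symm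
  have key : ∀ a b : Heisenberg, (a : Heisenberg ⧸ Subgroup.center Heisenberg) * b = b * a := by
    have hgen : ∀ a : Heisenberg, (∀ j, Commute
        (a : Heisenberg ⧸ Subgroup.center Heisenberg) (PresentedGroup.of (rels := heisRels) j)) →
        ∀ b : Heisenberg, Commute (a : Heisenberg ⧸ Subgroup.center Heisenberg) b := by
      intro a ha b
      have := PresentedGroup.generated_by heisRels
        ((Subgroup.centralizer {(a : Heisenberg ⧸ Subgroup.center Heisenberg)}).comap
          (QuotientGroup.mk' _)) (by
          intro j
          rw [Subgroup.mem_comap, Subgroup.mem_centralizer_singleton_iff]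
          exact (ha j).eq.symm) b
      rw [Subgroup.mem_comap, Subgroup.mem_centralizer_singleton_iff] at this
      exact Eq.symm this
    have hxy : Commute (Hx : Heisenberg ⧸ Subgroup.center Heisenberg) Hy := by
      have := congrArg (QuotientGroup.mk' (Subgroup.center Heisenberg)) Hx_mul_Hy.1
      have e : QuotientGroup.mk' (Subgroup.center Heisenberg) Hlam = 1 :=
        (QuotientGroup.eq_one_iff Hlam).mpr hlam
      rw [map_mul, map_mul, e, one_mul, map_mul] at this
      exact this
    intro a b
    refine hgen a (fun j => (hgen _ (fun i => ?_) a).symm) b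
    fin_cases j <;> fin_cases i
    · exact Commute.refl _
    · exact hxy
    · exact hxy.symm
    · exact Commute.refl _
  refine ⟨(h * g)⁻¹ * (g * h), ?_, by group⟩
  exact QuotientGroup.eq.mp (key h g)

theorem Heisenberg.commute_conj (h a b : Heisenberg) :
    Commute (a⁻¹ * h * a) (b⁻¹ * h * b) := by
  have H : ∀ a : Heisenberg, ∃ z ∈ Subgroup.center Heisenberg, a⁻¹ * h * a = h * z := by
    intro a
    obtain ⟨z, hz, e⟩ := Heisenberg.exists_swap h a
    exact ⟨z, hz, by rw [mul_assoc, e]; group⟩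
  obtain ⟨z, hz, ez⟩ := H a
  obtain ⟨w, hw, ew⟩ := H b
  rw [ez, ew]
  have cz : ∀ g, Commute g z := fun g => Subgroup.mem_center_iff.mp hz g
  have cw : ∀ g, Commute g w := fun g => Subgroup.mem_center_iff.mp hw g
  exact ((Commute.refl h).mul_right (cw h)).mul_left ((cz _).symm)

/-- An Ore condition for `1 + h`, with denominators that specialise to powers of a fixed scalar. -/
theorem exists_right_common_multiple {k Γ P A : Type*} [Field k] [Group Γ] [CommRing P] [Ring A]
    [Algebra k A] [Algebra P A] (Θ : MonoidAlgebra k Γ →ₐ[k] A) (h : Γ) (s : P)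
    (hs : Θ (MonoidAlgebra.of k Γ h) * Θ (MonoidAlgebra.of k Γ h) = algebraMap P A s)
    (hconj : ∀ a b : Γ, Commute (a⁻¹ * h * a) (b⁻¹ * h * b)) (a : MonoidAlgebra k Γ) :
    ∃ (c a' : MonoidAlgebra k Γ) (N : ℕ),
      a * c = (1 + MonoidAlgebra.of k Γ h) * a' ∧ Θ c = algebraMap P A ((1 - s) ^ N) := by
  set f := MonoidAlgebra.of k Γ with hf
  set S : Set (MonoidAlgebra k Γ) := Set.range fun g : Γ => 1 - f (g⁻¹ * h * g * (g⁻¹ * h * g))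
  have hS : Submonoid.closure S ≤ Submonoid.centralizer S := by
    rw [Submonoid.closure_le]
    rintro _ ⟨g, rfl⟩
    rw [SetLike.mem_coe, Submonoid.mem_centralizer_iff]
    rintro _ ⟨g', rfl⟩
    have hc := hconj g' g
    have hc' := (hc.mul_left hc).mul_right (hc.mul_left hc)
    have hc'' := hc'.map f
    exact ((Commute.one_left _).sub_left ((Commute.one_right _).sub_right hc'')).eq
  have hcomm : ∀ c ∈ Submonoid.closure S, ∀ d ∈ Submonoid.closure S, c * d = d * c := by
    intro c hc d hd
    have := Submonoid.closure_le_centralizer_centralizer S hd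
    rw [Submonoid.mem_centralizer_iff] at this
    exact this c (hS hc)
  suffices H : ∃ c ∈ Submonoid.closure S, ∃ (a' : MonoidAlgebra k Γ) (N : ℕ),
      a * c = (1 + f h) * a' ∧ Θ c = algebraMap P A ((1 - s) ^ N) by
    obtain ⟨c, -, H⟩ := H
    exact ⟨c, H⟩
  induction a using MonoidAlgebra.induction_on with
  | of g =>
    refine ⟨1 - f (g⁻¹ * h * g * (g⁻¹ * h * g)), Submonoid.subset_closure ⟨g, rfl⟩,
      (1 - f h) * f g, 1, ?_, ?_⟩
    · have e : (1 + f h) * (1 - f h) = 1 - f (h * h) := by rw [map_mul]; noncomm_ring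
      have e' : g * (g⁻¹ * h * g * (g⁻¹ * h * g)) = h * h * g := by group
      change f g * _ = _
      rw [← mul_assoc (1 + f h), e, mul_sub, sub_mul, ← map_mul, ← map_mul, e', mul_one, one_mul]
    · have e : g⁻¹ * h * g * (g⁻¹ * h * g) = g⁻¹ * (h * h) * g := by group
      rw [e, map_sub, map_mul, map_mul, map_mul, map_one, map_mul, map_mul, map_mul, hs,
        ← Algebra.commutes, mul_assoc, ← map_mul Θ, ← map_mul f, inv_mul_cancel]
      simp
  | add a b ha hb =>
    obtain ⟨c, hc, a', N, e, t⟩ := ha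
    obtain ⟨d, hd, b', M, e', t'⟩ := hb
    refine ⟨c * d, mul_mem hc hd, a' * d + b' * c, N + M, ?_, ?_⟩
    · rw [add_mul, ← mul_assoc, e, hcomm c hc d hd, ← mul_assoc, e', mul_add]
      simp only [mul_assoc]
    · rw [map_mul, t, t', pow_add, map_mul]
  | smul r a ha =>
    obtain ⟨c, hc, a', N, e, t⟩ := ha
    exact ⟨c, hc, r • a', N, by rw [smul_mul_assoc, e, mul_smul_comm], t⟩

/-- The values of a word in units `1 + g b` of a division ring have numerators and denominators
whose specialisations are the word in `1 ± g b`, up to powers of the scalar `1 - s`. -/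
theorem exists_word_fraction {k Γ P A D : Type*} [Field k] [Group Γ] [CommRing P] [Ring A]
    [Algebra k A] [Algebra P A] [DivisionRing D] [Algebra k D]
    (Θ : MonoidAlgebra k Γ →ₐ[k] A) (φ : MonoidAlgebra k Γ →ₐ[k] D) (g : Bool → Γ) (s : P)
    (hs : ∀ b, Θ (MonoidAlgebra.of k Γ (g b)) * Θ (MonoidAlgebra.of k Γ (g b)) = algebraMap P A s)
    (hconj : ∀ h a b : Γ, Commute (a⁻¹ * h * a) (b⁻¹ * h * b)) (U : Bool → Dˣ)
    (hU : ∀ b, (U b : D) = φ (1 + MonoidAlgebra.of k Γ (g b))) (L : List (Bool × Bool)) :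
    ∃ (a b : MonoidAlgebra k Γ) (N M M' : ℕ),
      ((L.map fun l => cond l.2 (U l.1) (U l.1)⁻¹).prod : Dˣ) * φ b = φ a ∧
      Θ b = algebraMap P A ((1 - s) ^ N) ∧
      algebraMap P A ((1 - s) ^ M) * Θ a = (L.map fun l => cond l.2
          (1 + Θ (MonoidAlgebra.of k Γ (g l.1))) (1 - Θ (MonoidAlgebra.of k Γ (g l.1)))).prod *
        algebraMap P A ((1 - s) ^ M') ∧
      M' + L.countP (fun l => !l.2) = N + M := by
  induction L with
  | nil => exact ⟨1, 1, 0, 0, 0, by simp, by simp, by simp, by simp⟩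
  | cons l L ih =>
    obtain ⟨a, b, N, M, M', h1, h2, h3, h4⟩ := ih
    obtain ⟨i, _ | _⟩ := l
    · obtain ⟨c, a', N', e, t⟩ := exists_right_common_multiple Θ (g i) s (hs i) (hconj _) a
      refine ⟨a', b * c, N + N', M + 1, M' + N', ?_, ?_, ?_, ?_⟩
      · have : φ (a * c) = U i * φ a' := by rw [e, map_mul, hU]
        rw [List.map_cons, List.prod_cons, Units.val_mul, map_mul, mul_assoc, ← mul_assoc _ (φ b),
          h1, ← map_mul, this, cond_false, Units.inv_mul_cancel_left]
      · rw [map_mul, h2, t, pow_add, map_mul]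
      · have hδ : algebraMap P A (1 - s) * Θ a' =
            (1 - Θ (MonoidAlgebra.of k Γ (g i))) * (Θ a * algebraMap P A ((1 - s) ^ N')) := by
          rw [← t, ← map_mul Θ a, e, map_mul, ← mul_assoc, map_sub, ← hs i, map_add, map_one,
            map_one]
          noncomm_ring
        rw [pow_succ, map_mul, mul_assoc, hδ, ← mul_assoc, Algebra.commutes, mul_assoc,
          ← mul_assoc (algebraMap _ _ _) (Θ a), h3, List.map_cons, List.prod_cons, cond_false,
          pow_add, map_mul]
        simp only [mul_assoc]
      · simp only [List.countP_cons, Bool.not_false, if_true]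
        omega
    · refine ⟨(1 + MonoidAlgebra.of k Γ (g i)) * a, b, N, M, M', ?_, h2, ?_, ?_⟩
      · rw [List.map_cons, List.prod_cons, Units.val_mul, mul_assoc, h1, map_mul, cond_true, hU]
      · rw [map_mul, ← mul_assoc, Algebra.commutes, mul_assoc, h3, List.map_cons, List.prod_cons,
          map_add, map_one, cond_true, mul_assoc]
      · simpa [List.countP_cons] using h4

/-- The diagonal and antidiagonal reflections. -/
def reflectionMatrix (k : Type*) [Field k] (b : Bool) : Matrix (Fin 2) (Fin 2) k :=
  cond b !![1, 0; 0, -1] !![0, 1; 1, 0]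

/-- A vector spanning the image of `1 ± reflectionMatrix`. -/
def reflectionVec (k : Type*) [Field k] (l : Bool × Bool) : Fin 2 → k :=
  cond l.1 (cond l.2 ![1, 0] ![0, 1]) (cond l.2 ![1, 1] ![1, -1])

theorem cond_one_add_reflectionMatrix (k : Type*) [Field k] (l : Bool × Bool) :
    cond l.2 (1 + reflectionMatrix k l.1) (1 - reflectionMatrix k l.1) =
      Matrix.vecMulVec (reflectionVec k l) ((cond l.1 2 1 : k) • reflectionVec k l) := by
  obtain ⟨_ | _, _ | _⟩ := l <;> ext i j <;> fin_cases i <;> fin_cases j <;>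
    simp [reflectionMatrix, reflectionVec, Matrix.vecMulVec] <;> norm_num

theorem reflectionVec_dotProduct_ne_zero {k : Type*} [Field k] (h2 : (2 : k) ≠ 0)
    {l l' : Bool × Bool} (h : l.1 = l'.1 → l.2 = l'.2) :
    (cond l.1 2 1 : k) • reflectionVec k l ⬝ᵥ reflectionVec k l' ≠ 0 := by
  obtain ⟨_ | _, _ | _⟩ := l <;> obtain ⟨_ | _, _ | _⟩ := l' <;> revert h <;>
    simp [reflectionVec, h2] <;> norm_num [h2]

theorem exists_prod_eq_vecMulVec {k : Type*} [Field k] (h2 : (2 : k) ≠ 0) (l : Bool × Bool)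
    (L : List (Bool × Bool)) (hL : FreeGroup.IsReduced (l :: L)) :
    ∃ r ≠ 0, ((l :: L).map fun l => cond l.2 (1 + reflectionMatrix k l.1)
      (1 - reflectionMatrix k l.1)).prod = Matrix.vecMulVec (reflectionVec k l) r := by
  induction L generalizing l with
  | nil =>
    refine ⟨_, ?_, by
      rw [List.map_singleton, List.prod_singleton, cond_one_add_reflectionMatrix]⟩
    intro h0
    exact reflectionVec_dotProduct_ne_zero h2 (l := l) (l' := l) (fun _ => rfl)
      (by rw [h0, zero_dotProduct])
  | cons l' L ih =>
    rw [FreeGroup.isReduced_cons_cons] at hL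
    obtain ⟨r, hr, e⟩ := ih l' hL.2
    rw [List.map_cons, List.prod_cons, e, cond_one_add_reflectionMatrix,
      Matrix.vecMulVec_mul_vecMulVec]
    exact ⟨_, smul_ne_zero (reflectionVec_dotProduct_ne_zero h2 hL.1) hr, rfl⟩

theorem reflectionVec_ne_zero (k : Type*) [Field k] (l : Bool × Bool) : reflectionVec k l ≠ 0 := by
  obtain ⟨_ | _, _ | _⟩ := l <;> simp [reflectionVec]

/-- Units `1 + g b` are free if the `g b` specialise to matrices deforming two reflections. -/
theorem injective_lift_of_specialization {k Γ P D : Type*} [Field k] [Group Γ] [CommRing P]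
    [IsDomain P] [Algebra k P] [DivisionRing D] [Algebra k D] (h2 : (2 : k) ≠ 0)
    (Θ : MonoidAlgebra k Γ →ₐ[k] Matrix (Fin 2) (Fin 2) P) (φ : MonoidAlgebra k Γ →ₐ[k] D)
    (hφ : Function.Injective φ) (g : Bool → Γ) (s : P) (hs1 : s ≠ 1)
    (hs : ∀ b, Θ (MonoidAlgebra.of k Γ (g b)) * Θ (MonoidAlgebra.of k Γ (g b)) =
      algebraMap P _ s)
    (ε : P →+* k) (hε : ε s = 1)
    (hg : ∀ b, ε.mapMatrix (Θ (MonoidAlgebra.of k Γ (g b))) = reflectionMatrix k b)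
    (hconj : ∀ h a b : Γ, Commute (a⁻¹ * h * a) (b⁻¹ * h * b)) (U : Bool → Dˣ)
    (hU : ∀ b, (U b : D) = φ (1 + MonoidAlgebra.of k Γ (g b))) :
    Function.Injective (FreeGroup.lift U) := by
  rw [injective_iff_map_eq_one]
  intro w hw
  by_contra hne
  obtain ⟨l, L, hlL⟩ : ∃ l L, w.toWord = l :: L :=
    List.exists_cons_of_ne_nil (mt FreeGroup.toWord_eq_nil_iff.mp hne)
  have hred : FreeGroup.IsReduced (l :: L) := hlL ▸ FreeGroup.isReduced_toWord
  rw [← FreeGroup.mk_toWord (x := w), hlL, FreeGroup.lift_mk] at hw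
  obtain ⟨a, b, N, M, M', e1, e2, e3, e4⟩ := exists_word_fraction Θ φ g s hs hconj U hU (l :: L)
  obtain ⟨r, hr, e⟩ := exists_prod_eq_vecMulVec h2 l L hred
  rw [hw, Units.val_one, one_mul] at e1
  rw [← hφ e1, e2, ← map_mul, ← pow_add, add_comm M N, ← e4, add_comm M', pow_add,
    map_mul, Algebra.algebraMap_eq_smul_one ((1 - s) ^ M'), mul_smul_comm, mul_smul_comm] at e3
  have e5 := smul_right_injective _ (pow_ne_zero M' (sub_ne_zero.mpr hs1.symm)) e3
  rw [mul_one, mul_one] at e5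
  have e6 := congrArg ε.mapMatrix e5
  rw [map_list_prod, List.map_map] at e6
  have e7 : (ε.mapMatrix ∘ fun l : Bool × Bool => cond l.2
      (1 + Θ (MonoidAlgebra.of k Γ (g l.1))) (1 - Θ (MonoidAlgebra.of k Γ (g l.1)))) =
      fun l => cond l.2 (1 + reflectionMatrix k l.1) (1 - reflectionMatrix k l.1) := by
    funext l
    rw [Function.comp_apply, ← hg]
    cases l.2 <;> simp only [cond_true, cond_false, map_add, map_sub, map_one]
  rw [e7, e, Algebra.algebraMap_eq_smul_one] at e6
  rcases Nat.eq_zero_or_pos ((l :: L).countP fun l => !l.2) with h0 | h0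
  · rw [h0, pow_zero, one_smul, map_one] at e6
    have := congrArg Matrix.det e6
    simp [Matrix.det_fin_two, Matrix.vecMulVec_apply] at this
    exact one_ne_zero (this.trans (by ring))
  · have hz : ε.mapMatrix ((1 - s) ^ (List.countP (fun l => !l.2) (l :: L)) •
        (1 : Matrix (Fin 2) (Fin 2) P)) = 0 := by
      ext i j
      simp [hε, h0.ne']
    rw [hz] at e6
    rcases Matrix.vecMulVec_eq_zero.mp e6.symm with h | h
    · exact reflectionVec_ne_zero k l h
    · exact hr h

theorem Heisenberg.exists_hom {G : Type*} [Group G] {p q z : G} (hz : ∀ g, Commute z g)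
    (h : p * q = z * (q * p)) : ∃ F : Heisenberg →* G, F Hx = p ∧ F Hy = q ∧ F Hlam = z := by
  have hpq : commS p q = z := by
    rw [commS, mul_assoc, h, ← mul_assoc, ← (hz _).eq]
    group
  have hc : ∀ g, commS z g = 1 := fun g => by
    rw [commS, mul_assoc, (hz g).eq]
    group
  let f : Fin 2 → G := ![p, q]
  have e : FreeGroup.lift f (commS (FreeGroup.of 0) (FreeGroup.of 1)) = z := by
    rw [← hpq]
    simp [commS, f]
  have e' : ∀ j, FreeGroup.lift f
      (commS (commS (FreeGroup.of 0) (FreeGroup.of 1)) (FreeGroup.of j)) = 1 := by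
    intro j
    rw [← hc (f j), ← e]
    simp [commS]
  have hrel : ∀ r ∈ heisRels, FreeGroup.lift f r = 1 := by
    rintro r (rfl | rfl)
    · exact e' 0
    · exact e' 1
  have h0 : PresentedGroup.toGroup hrel Hx = p := PresentedGroup.toGroup.of hrel
  have h1 : PresentedGroup.toGroup hrel Hy = q := PresentedGroup.toGroup.of hrel
  refine ⟨PresentedGroup.toGroup hrel, h0, h1, ?_⟩
  rw [← hpq, ← h0, ← h1]
  simp [Hlam, commS]

theorem mul_zpow_mul_of_central {G : Type*} [Group G] {p q z : G} (hz : ∀ g, Commute z g)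
    (h : p * q = z * (q * p)) (a b : ℤ) :
    z ^ a * p * (z ^ b * q) = z * (z ^ b * q * (z ^ a * p)) := by
  have hz' : ∀ (a : ℤ) g, Commute (z ^ a) g := fun a g => (hz g).zpow_left a
  calc z ^ a * p * (z ^ b * q) = z ^ a * z ^ b * (p * q) := (hz' b p).symm.mul_mul_mul_comm _ _
    _ = z * (z ^ b * z ^ a * (q * p)) := by
      rw [h, (hz' a _).eq, ← mul_assoc, ← (hz _).eq, mul_assoc]
    _ = z * (z ^ b * q * (z ^ a * p)) := by
      rw [(hz' a q).mul_mul_mul_comm]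

/-- If `m` and `n` are not both odd, some `X, Y` fixed by the involution `x ↦ λ ^ m * x`,
`y ↦ λ ^ n * y` have the universal property of the generators. -/
theorem Heisenberg.exists_symmetric_generators (gstar : Heisenberg → Heisenberg)
    (hmul : ∀ g h : Heisenberg, gstar (g * h) = gstar h * gstar g) (m n : ℤ)
    (hx : gstar Hx = Hlam ^ m * Hx) (hy : gstar Hy = Hlam ^ n * Hy) (hpar : ¬ (Odd m ∧ Odd n)) :
    ∃ X Y : Heisenberg, gstar X = X ∧ gstar Y = Y ∧
      ∀ {G : Type u} [Group G] {p q z : G}, (∀ g, Commute z g) → p * q = z * (q * p) →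
        ∃ F : Heisenberg →* G, F X = p ∧ F Y = q := by
  have hlc := Hx_mul_Hy.2
  have hlz : ∀ (a : ℤ) g, Commute (Hlam ^ a) g := fun a g => (hlc g).zpow_left a
  let f : Heisenberg →* Heisenberg := MonoidHom.mk' (fun g => (gstar g)⁻¹) fun g h => by
    rw [hmul, mul_inv_rev]
  have hf : ∀ g, f g = (gstar g)⁻¹ := fun _ => rfl
  have hfl : f Hlam = Hlam := by
    have : f Hlam = commS (f Hx) (f Hy) := by simp [Hlam, commS]
    rw [this, hf, hf, hx, hy, commS, inv_inv, inv_inv, mul_zpow_mul_of_central hlc Hx_mul_Hy.1]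
    group
  have hgl : ∀ a : ℤ, gstar (Hlam ^ a) = Hlam ^ (-a) := by
    intro a
    rw [zpow_neg, ← inv_inv (gstar _), ← hf, map_zpow, hfl]
  have hX : ∀ a, m = a + a → gstar (Hlam ^ a * Hx) = Hlam ^ a * Hx := by
    rintro a rfl
    rw [hmul, hx, hgl, mul_assoc, ← (hlz (-a) Hx).eq, ← mul_assoc, ← zpow_add]
    congr 2
    ring
  have hY : ∀ a, n = a + a → gstar (Hlam ^ a * Hy) = Hlam ^ a * Hy := by
    rintro a rfl
    rw [hmul, hy, hgl, mul_assoc, ← (hlz (-a) Hy).eq, ← mul_assoc, ← zpow_add]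
    congr 2
    ring
  have hXY : ∀ c, m + n = 2 * c + 1 → gstar (Hlam ^ c * (Hx * Hy)) = Hlam ^ c * (Hx * Hy) := by
    intro c hc
    have e : Hlam ^ n * Hy * (Hlam ^ m * Hx) = Hlam ^ (n + m) * (Hy * Hx) := by
      rw [zpow_add, mul_assoc, mul_assoc, ← mul_assoc Hy, ← (hlz m Hy).eq, mul_assoc]
    have e' : Hlam ^ (n + m) * (Hy * Hx) = Hlam ^ (2 * c) * (Hx * Hy) := by
      rw [add_comm, hc, zpow_add, zpow_one, mul_assoc, ← Hx_mul_Hy.1]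
    rw [hmul, hmul, hx, hy, hgl, e, e', ← (hlz _ _).eq, ← mul_assoc, ← zpow_add]
    congr 2
    ring
  rcases Int.even_or_odd m with ⟨a, ha⟩ | hm <;> rcases Int.even_or_odd n with ⟨b, hb⟩ | hn
  · refine ⟨_, _, hX a ha, hY b hb, fun {G} _ {p q z} hz h => ?_⟩
    obtain ⟨F, h0, h1, h2⟩ := Heisenberg.exists_hom hz (mul_zpow_mul_of_central hz h (-a) (-b))
    exact ⟨F, by simp [h0, h2], by simp [h1, h2]⟩
  · obtain ⟨b, hb⟩ := hn
    refine ⟨_, _, hX a ha, hXY (a + b) (by omega), fun {G} _ {p q z} hz h => ?_⟩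
    have h' := mul_zpow_mul_of_central hz h (-a) (-(a + b))
    obtain ⟨F, h0, h1, h2⟩ := Heisenberg.exists_hom (p := z ^ (-a) * p)
      (q := (z ^ (-a) * p)⁻¹ * (z ^ (-(a + b)) * q)) hz (by
        rw [mul_inv_cancel_left, mul_assoc _ _ (z ^ (-a) * p), ← mul_assoc z, (hz _).eq, mul_assoc,
          ← h', inv_mul_cancel_left])
    exact ⟨F, by simp [h0, h2], by
      rw [map_mul, map_mul, map_zpow, h0, h1, h2, mul_inv_cancel_left, zpow_neg,
        mul_inv_cancel_left]⟩
  · obtain ⟨a, ha⟩ := hm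
    refine ⟨_, _, hXY (a + b) (by omega), hY b hb, fun {G} _ {p q z} hz h => ?_⟩
    have h' := mul_zpow_mul_of_central hz h (-(a + b)) (-b)
    obtain ⟨F, h0, h1, h2⟩ := Heisenberg.exists_hom (q := z ^ (-b) * q)
      (p := (z ^ (-(a + b)) * p) * (z ^ (-b) * q)⁻¹) hz (by
        rw [inv_mul_cancel_right, ← mul_assoc _ _ (z ^ (-b) * q)⁻¹, ← mul_assoc z, ← h',
          mul_inv_cancel_right])
    exact ⟨F, by
      rw [map_mul, map_mul, map_zpow, h0, h1, h2, inv_mul_cancel_right, zpow_neg,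
        mul_inv_cancel_left], by simp [h1, h2]⟩
  · exact absurd ⟨hm, hn⟩ hpar

open PowerSeries in
theorem exists_reflection_deformation (k : Type*) [Field k] :
    ∃ R : Bool → (Matrix (Fin 2) (Fin 2) k⟦X⟧)ˣ,
      (∀ b, (R b * R b : Matrix (Fin 2) (Fin 2) k⟦X⟧) = algebraMap k⟦X⟧ _ ((1 + X) ^ 2)) ∧
      (∀ b, (constantCoeff (R := k)).mapMatrix (R b : Matrix (Fin 2) (Fin 2) k⟦X⟧) =
        reflectionMatrix k b) ∧ R true * R false = -1 * (R false * R true) := by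
  let E : Bool → Matrix (Fin 2) (Fin 2) k⟦X⟧ := fun b =>
    (1 + X : k⟦X⟧) • (C (R := k)).mapMatrix (reflectionMatrix k b)
  have hE : ∀ b, E b * E b = algebraMap k⟦X⟧ _ ((1 + X) ^ 2) := by
    intro b
    rw [Algebra.algebraMap_eq_smul_one, sq]
    cases b <;> ext i j : 2 <;> fin_cases i <;> fin_cases j <;>
      (simp [E, reflectionMatrix, Matrix.mul_apply]; try ring_nf)
  have hu : IsUnit ((1 + X : k⟦X⟧) ^ 2) := by
    rw [PowerSeries.isUnit_iff_constantCoeff]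
    simp
  have hEu : ∀ b, IsUnit (E b) := fun b => by
    have := hu.map (algebraMap k⟦X⟧ (Matrix (Fin 2) (Fin 2) k⟦X⟧))
    rw [← hE b] at this
    exact ((Commute.refl (E b)).isUnit_mul_iff.mp this).1
  refine ⟨fun b => (hEu b).unit, hE, fun b => ?_, ?_⟩
  · ext i j
    simp [E]
  · ext i j : 3
    simp only [Units.val_mul, IsUnit.unit_spec, E, Units.val_neg,
      smul_mul_smul_comm, ← map_mul, neg_one_mul]
    fin_cases i <;> fin_cases j <;> simp [reflectionMatrix]

theorem free_symmetric_pair_heisenberg_type_I_not_both_odd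
    (k : Type*) [Field k] (hchar : ringChar k ≠ 2)
    (D : Type*) [DivisionRing D] [Algebra k D]
    (φ : MonoidAlgebra k Heisenberg →ₐ[k] D)
    (hφinj : Function.Injective φ)
    (hquot : ∀ d : D, ∃ a b : MonoidAlgebra k Heisenberg, φ b ≠ 0 ∧ d = φ a * (φ b)⁻¹)
    (gstar : Heisenberg → Heisenberg)
    (hgstar_mul : ∀ g h : Heisenberg, gstar (g * h) = gstar h * gstar g)
    (hgstar_invol : ∀ g : Heisenberg, gstar (gstar g) = g)
    (invol : D →ₗ[k] D)
    (hinvol_mul : ∀ c d : D, invol (c * d) = invol d * invol c)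
    (hinvol_invol : ∀ c : D, invol (invol c) = c)
    (hinduced : ∀ g : Heisenberg,
      invol (φ (MonoidAlgebra.of k Heisenberg g)) = φ (MonoidAlgebra.of k Heisenberg (gstar g)))
    (m n : ℤ)
    (hxm : gstar Hx = Hlam ^ m * Hx) (hyn : gstar Hy = Hlam ^ n * Hy)
    (hpar : ¬ (Odd m ∧ Odd n)) :
    ∃ u v : Dˣ, IsFreePair u v ∧ invol (u : D) = (u : D) ∧ invol (v : D) = (v : D) := by
  obtain ⟨X, Y, hX, hY, hF⟩ :=
    Heisenberg.exists_symmetric_generators gstar hgstar_mul m n hxm hyn hpar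
  obtain ⟨R, hRR, hRc, hcomm⟩ := exists_reflection_deformation k
  obtain ⟨F, hFX, hFY⟩ := hF (fun g => Commute.neg_one_left g) hcomm
  have h2 : (2 : k) ≠ 0 := Ring.two_ne_zero hchar
  let Θ := MonoidAlgebra.lift k (Matrix (Fin 2) (Fin 2) (PowerSeries k)) Heisenberg
    ((Units.coeHom _).comp F)
  let g : Bool → Heisenberg := fun b => cond b X Y
  have hΘ : ∀ b, Θ (MonoidAlgebra.of k Heisenberg (g b)) = R b := by
    intro b
    rw [MonoidAlgebra.lift_of]
    cases b
    · exact congrArg Units.val hFY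
    · exact congrArg Units.val hFX
  have hne : ∀ b, φ (1 + MonoidAlgebra.of k Heisenberg (g b)) ≠ 0 := by
    intro b h
    rw [map_eq_zero_iff φ hφinj] at h
    have := congrArg (fun t => (PowerSeries.constantCoeff (R := k)).mapMatrix (Θ t)) h
    simp only [map_add, map_one, map_zero, hΘ, hRc] at this
    have e := cond_one_add_reflectionMatrix k (b, true)
    rw [cond_true, this, eq_comm, Matrix.vecMulVec_eq_zero] at e
    refine e.elim (reflectionVec_ne_zero k _) fun e => ?_
    exact reflectionVec_dotProduct_ne_zero h2 (l := (b, true)) (l' := (b, true)) (fun _ => rfl)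
      (by rw [e, zero_dotProduct])
  have hs1 : ((1 + PowerSeries.X : PowerSeries k) ^ 2) ≠ 1 := by
    intro h
    have := congrArg (PowerSeries.coeff 1) h
    simp [add_sq, PowerSeries.coeff_one, PowerSeries.coeff_X_pow] at this
    exact h2 ((map_ofNat PowerSeries.constantCoeff 2).symm.trans this)
  have hinv : ∀ g, gstar g = g →
      invol (φ (1 + MonoidAlgebra.of k Heisenberg g)) = φ (1 + MonoidAlgebra.of k Heisenberg g) := by
    intro g hg
    have h1 : gstar 1 = 1 := by simpa using hgstar_mul 1 1
    rw [← map_one (MonoidAlgebra.of k Heisenberg), map_add, map_add, hinduced, hinduced, h1, hg]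
  have hfree := injective_lift_of_specialization h2 Θ φ hφinj g _ hs1
    (fun b => by rw [hΘ, hRR]) PowerSeries.constantCoeff (by simp) (fun b => by rw [hΘ, hRc])
    Heisenberg.commute_conj (fun b => Units.mk0 _ (hne b)) (fun _ => rfl)
  refine ⟨Units.mk0 _ (hne true), Units.mk0 _ (hne false), ?_, hinv X hX, hinv Y hY⟩
  refine Eq.mp (congrArg (fun f : Bool → Dˣ => Function.Injective (FreeGroup.lift f)) ?_) hfree
  funext b
  cases b <;> rfl
end
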